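/- arXiv:0708.2895 — 2 statements merged into one kernel-verified Lean document; each statement's English description precedes it below -/
import Mathlib

section
/- Let κ ≥ 1, 0 < ε ≤ 1 and C > 0. Then there exist n₀ ≥ 1 and a function δ: ℕ → (0,∞) with δ(n) → 0 as n → ∞ (all depending only on κ, ε, C) such that the following holds for every n ≥ n₀: let α be a complex random variable with κ-controlled second moment, let β ≥ exp(−n^{ε/2}) and n^{−C} ≤ p ≤ 1, and let S_{n,α,β,p} be the set of all unit vectors v ∈ ℂⁿ with p_{β,α}(v) ≥ p. Then there exists a set S' ⊆ ℂⁿ of cardinality at most n^{(−1/2+ε)n}·p^{−n} + exp(δ(n)·n) such that for every v ∈ S_{n,α,β,p} there is v' ∈ S' with ‖v − v'‖_∞ ≤ β, where ‖(v₁,…,vₙ)‖_∞ := max_{1≤i≤n}|v_i|. -/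
open MeasureTheory ProbabilityTheory Filter

noncomputable section

/-- The operator (spectral) norm of an `n × n` complex matrix, i.e. the supremum of `‖M v‖`
over unit vectors `v` in Euclidean space. -/
def opNorm {n : ℕ} (M : Matrix (Fin n) (Fin n) ℂ) : ℝ :=
  ‖(Matrix.toEuclideanCLM (𝕜 := ℂ) M : EuclideanSpace ℂ (Fin n) →L[ℂ] EuclideanSpace ℂ (Fin n))‖

/-- The least singular value of an `n × n` complex matrix: `σ_n(M) = inf_{‖v‖ = 1} ‖M v‖`. -/
def sigmaMin {n : ℕ} (M : Matrix (Fin n) (Fin n) ℂ) : ℝ :=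
  ⨅ v : {v : EuclideanSpace ℂ (Fin n) // ‖v‖ = 1},
    ‖Matrix.toEuclideanCLM (𝕜 := ℂ) M v.1‖

open Classical in
/-- The empirical spectral distribution of an `n × n` complex matrix:
`ESD M s t = (1/n) * #{eigenvalues λ (with multiplicity) : Re λ ≤ s, Im λ ≤ t}`,
eigenvalues with multiplicity being the roots of the characteristic polynomial. -/
def ESD {n : ℕ} (M : Matrix (Fin n) (Fin n) ℂ) (s t : ℝ) : ℝ :=
  ((M.charpoly.roots.filter (fun z => z.re ≤ s ∧ z.im ≤ t)).card : ℝ) / n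

/-- The distribution function of the uniform probability measure on the unit disk:
`μ_∞(s,t) = (1/π) · mes {z : |z| ≤ 1, Re z ≤ s, Im z ≤ t}`. -/
def unifDiskCDF (s t : ℝ) : ℝ :=
  (volume {z : ℂ | ‖z‖ ≤ 1 ∧ z.re ≤ s ∧ z.im ≤ t}).toReal / Real.pi

/-- The law (on `ℂ`) of a Bernoulli random variable which equals `1` with probability `ρ`
and `0` with probability `1 - ρ`. -/
def bernoulliLawC (ρ : ℝ) : Measure ℂ :=
  ENNReal.ofReal ρ • Measure.dirac 1 + ENNReal.ofReal (1 - ρ) • Measure.dirac 0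

/-- The law of `α · I_μ`, the product of a random variable with law `ν` and an independent
Bernoulli variable equal to `1` with probability `μ` and `0` otherwise. -/
def bernoulliMix (ν : Measure ℂ) (μ : ℝ) : Measure ℂ :=
  ENNReal.ofReal μ • ν + ENNReal.ofReal (1 - μ) • Measure.dirac 0

/-- The law of `α^{(μ)} := (α₁ - α₂) · I_{μ/2}` where `α₁, α₂` are i.i.d. with law `ν` and
`I_{μ/2}` is an independent Bernoulli variable equal to `1` with probability `μ/2`. -/
def diffLaw (ν : Measure ℂ) (μ : ℝ) : Measure ℂ :=
  ENNReal.ofReal (μ / 2) • Measure.map (fun p : ℂ × ℂ => p.1 - p.2) (ν.prod ν)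
    + ENNReal.ofReal (1 - μ / 2) • Measure.dirac 0

/-- The concentration probability `P_μ(v) := E exp(-π |W_{α^{(μ)}}(v)|²)`, where
`W_{α^{(μ)}}(v) = ∑ i, v i · x i` with `x i` i.i.d. copies of `α^{(μ)}` and `ν` is the law
of `α`. -/
def concProb {ι : Type*} [Fintype ι] (ν : Measure ℂ) (μ : ℝ) (v : ι → ℂ) : ℝ :=
  ∫ x, Real.exp (-Real.pi * ‖∑ i, v i * x i‖ ^ 2) ∂(Measure.pi fun _ : ι => diffLaw ν μ)

/-- The small ball probability `p_{r,α}(v) := sup_z P(W_α(v) ∈ B(z,r))`, where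
`W_α(v) = ∑ i, v i · x i` with `x i` i.i.d. copies of a random variable with law `ν`. -/
def smallBall {ι : Type*} [Fintype ι] (ν : Measure ℂ) (v : ι → ℂ) (r : ℝ) : ℝ :=
  ⨆ z : ℂ, ((Measure.pi fun _ : ι => ν) {x | dist (∑ i, v i * x i) z ≤ r}).toReal

/-- The characteristic function `f(z) := |E e(Re(α z))|²` where `e(t) = e^{2π√-1 t}` and
`ν` is the law of `α`. -/
def charFn (ν : Measure ℂ) (z : ℂ) : ℝ :=
  ‖∫ w, Complex.exp (2 * Real.pi * Complex.I * ((w * z).re : ℂ)) ∂ν‖ ^ 2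

/-- The `α`-norm `‖w‖_α := (E ‖Re(w (α₁ - α₂))‖_{ℝ/ℤ}²)^{1/2}` where `α₁, α₂` are i.i.d.
with law `ν`, and `‖t‖_{ℝ/ℤ} = |t - round t|` is the distance to the nearest integer. -/
def alphaNorm (ν : Measure ℂ) (w : ℂ) : ℝ :=
  Real.sqrt (∫ p : ℂ × ℂ,
    |(w * (p.1 - p.2)).re - (round ((w * (p.1 - p.2)).re) : ℝ)| ^ 2 ∂(ν.prod ν))

/-- The symmetric generalized arithmetic progression with generators `v i` and dimensions
`L i`: the set of `∑ i, m i • v i` with `m i ∈ ℤ`, `|m i| ≤ L i`. -/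
def GAPset {r : ℕ} (v : Fin r → ℂ) (L : Fin r → ℝ) : Set ℂ :=
  {z | ∃ m : Fin r → ℤ, (∀ i, |(m i : ℝ)| ≤ L i) ∧ z = ∑ i, (m i : ℂ) * v i}

/-- The dispersion `D(Q) := #Q / #(Q ∩ B(0,1))` of a finite set `Q ⊆ ℂ`. -/
def dispersion (Q : Set ℂ) : ℝ :=
  (Q.ncard : ℝ) / ((Q ∩ Metric.closedBall 0 1).ncard : ℝ)

/-- A complex random variable `α` has `κ`-controlled second moment if `κ ≥ 1`,
`E|α|² ≤ κ`, and `E[(Re(zα - w))² 1_{|α| ≤ κ}] ≥ Re(z)²/κ` for all `z w : ℂ`. -/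
def HasControlledSecondMoment {Ω : Type*} [MeasureSpace Ω] (α : Ω → ℂ) (κ : ℝ) : Prop :=
  1 ≤ κ ∧ Integrable (fun ω => ‖α ω‖ ^ 2) ∧ (∫ ω, ‖α ω‖ ^ 2) ≤ κ ∧
    ∀ z w : ℂ, z.re ^ 2 / κ ≤ ∫ ω in {ω | ‖α ω‖ ≤ κ}, ((z * α ω - w).re) ^ 2

end

/-! ### The characteristic integral and the phase gap -/

/-- The characteristic integral `∫ exp(i Re(w a)) dμ(a)`. -/
noncomputable def charInt (μ : Measure ℂ) (w : ℂ) : ℂ :=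
  ∫ a, Complex.exp (((w * a).re : ℝ) * Complex.I) ∂μ

/-- The defect `1 - |∫ exp(i Re(w a)) dμ(a)|²`. -/
noncomputable def phaseGap (μ : Measure ℂ) (w : ℂ) : ℝ := 1 - ‖charInt μ w‖ ^ 2

lemma norm_charInt_le_one (μ : Measure ℂ) [IsProbabilityMeasure μ] (w : ℂ) :
    ‖charInt μ w‖ ≤ 1 := by
  have := norm_integral_le_of_norm_le_const (μ := μ) (C := 1)
    (f := fun a : ℂ => Complex.exp (((w * a).re : ℝ) * Complex.I))
    (by filter_upwards with a; rw [Complex.norm_exp_ofReal_mul_I])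
  simpa [charInt] using this

lemma phaseGap_nonneg (μ : Measure ℂ) [IsProbabilityMeasure μ] (w : ℂ) : 0 ≤ phaseGap μ w := by
  have h := norm_charInt_le_one μ w
  have h0 := norm_nonneg (charInt μ w)
  unfold phaseGap
  nlinarith

lemma phaseGap_le_one (μ : Measure ℂ) (w : ℂ) : phaseGap μ w ≤ 1 := by
  unfold phaseGap
  nlinarith [sq_nonneg ‖charInt μ w‖]

lemma norm_charInt_le_exp (μ : Measure ℂ) (w : ℂ) :
    ‖charInt μ w‖ ≤ Real.exp (-phaseGap μ w / 2) := by
  refine abs_le_of_sq_le_sq' ?_ (Real.exp_pos _).le |>.2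
  rw [← Real.exp_nat_mul]
  have := Real.add_one_le_exp (-phaseGap μ w)
  have h2 : ((2 : ℕ) : ℝ) * (-phaseGap μ w / 2) = -phaseGap μ w := by push_cast; ring
  rw [h2]
  unfold phaseGap at *
  linarith

lemma continuous_phase_diff (w : ℂ) :
    Continuous fun z : ℂ × ℂ => (w * (z.1 - z.2)).re :=
  Complex.continuous_re.comp (by fun_prop)

lemma integrable_one_sub_cos (μ : Measure ℂ) [IsProbabilityMeasure μ] (w : ℂ) :
    Integrable (fun z : ℂ × ℂ => 1 - Real.cos ((w * (z.1 - z.2)).re)) (μ.prod μ) := by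
  refine Integrable.of_bound
    ((continuous_const.sub (Real.continuous_cos.comp
      (continuous_phase_diff w))).aestronglyMeasurable) 2 ?_
  filter_upwards with z
  rw [Real.norm_eq_abs, abs_le]
  constructor <;> linarith [Real.cos_le_one ((w * (z.1 - z.2)).re),
    Real.neg_one_le_cos ((w * (z.1 - z.2)).re)]

lemma phaseGap_eq_integral (μ : Measure ℂ) [IsProbabilityMeasure μ] (w : ℂ) :
    phaseGap μ w = ∫ z : ℂ × ℂ, 1 - Real.cos ((w * (z.1 - z.2)).re) ∂(μ.prod μ) := by
  have hcos : Integrable (fun z : ℂ × ℂ => Real.cos ((w * (z.1 - z.2)).re)) (μ.prod μ) := by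
    have := (integrable_const (1 : ℝ)).sub (integrable_one_sub_cos μ w)
    refine this.congr ?_
    filter_upwards with z
    simp
  rw [integral_sub (integrable_const _) hcos]
  simp only [integral_const, probReal_univ, smul_eq_mul, mul_one, phaseGap]
  congr 1
  have h1 : ((‖charInt μ w‖ ^ 2 : ℝ) : ℂ)
      = ∫ z : ℂ × ℂ, Complex.exp (((w * (z.1 - z.2)).re : ℝ) * Complex.I) ∂(μ.prod μ) := by
    have h2 : ((‖charInt μ w‖ ^ 2 : ℝ) : ℂ)
        = charInt μ w * (starRingEnd ℂ) (charInt μ w) := by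
      rw [Complex.mul_conj, Complex.normSq_eq_norm_sq]
    rw [h2, charInt, ← integral_conj, ← integral_prod_mul]
    refine integral_congr_ae ?_
    filter_upwards with z
    rw [← Complex.exp_conj, ← Complex.exp_add]
    congr 1
    simp [mul_sub, sub_mul]
    ring
  have h3 := congrArg Complex.re h1
  rw [Complex.ofReal_re] at h3
  rw [h3]
  have hint : Integrable (fun z : ℂ × ℂ =>
      Complex.exp (((w * (z.1 - z.2)).re : ℝ) * Complex.I)) (μ.prod μ) := by
    refine Integrable.of_bound ?_ 1 ?_
    · have := continuous_phase_diff w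
      exact Continuous.aestronglyMeasurable (by fun_prop)
    · filter_upwards with a
      rw [Complex.norm_exp_ofReal_mul_I]
  have := integral_re hint
  simp only [RCLike.re_to_complex, Complex.exp_ofReal_mul_I_re] at this
  exact this.symm

lemma abs_sin_nat_mul_le (j : ℕ) (x : ℝ) : |Real.sin (j * x)| ≤ j * |Real.sin x| := by
  induction j with
  | zero => simp
  | succ j ih =>
    push_cast
    rw [add_mul, one_mul, Real.sin_add]
    have h1 := abs_add_le (Real.sin (j * x) * Real.cos x) (Real.cos (j * x) * Real.sin x)
    rw [abs_mul, abs_mul] at h1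
    have h2 := mul_le_of_le_one_right (abs_nonneg (Real.sin (j * x))) (Real.abs_cos_le_one x)
    have h3 := mul_le_of_le_one_left (abs_nonneg (Real.sin x)) (Real.abs_cos_le_one (j * x))
    linarith

lemma one_sub_cos_eq (x : ℝ) : 1 - Real.cos x = 2 * Real.sin (x / 2) ^ 2 := by
  have := Real.cos_sq' (x / 2)
  have h2 := Real.cos_two_mul (x / 2)
  rw [mul_div_cancel₀ x (two_ne_zero)] at h2
  linarith

lemma one_sub_cos_combo_le (j l : ℕ) (x y : ℝ) :
    1 - Real.cos (j * x + l * y)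
      ≤ (j + l) * (j * (1 - Real.cos x) + l * (1 - Real.cos y)) := by
  rw [one_sub_cos_eq, one_sub_cos_eq x, one_sub_cos_eq y]
  have e : (j * x + l * y) / 2 = j * (x / 2) + l * (y / 2) := by ring
  rw [e, Real.sin_add]
  set a := |Real.sin (x / 2)|
  set b := |Real.sin (y / 2)|
  have ha : Real.sin (x / 2) ^ 2 = a ^ 2 := (sq_abs _).symm
  have hb : Real.sin (y / 2) ^ 2 = b ^ 2 := (sq_abs _).symm
  have h1 := abs_add_le (Real.sin (j * (x / 2)) * Real.cos (l * (y / 2)))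
    (Real.cos (j * (x / 2)) * Real.sin (l * (y / 2)))
  rw [abs_mul, abs_mul] at h1
  have h2 := mul_le_of_le_one_right (abs_nonneg (Real.sin (j * (x / 2))))
    (Real.abs_cos_le_one (l * (y / 2)))
  have h3 := mul_le_of_le_one_left (abs_nonneg (Real.sin (l * (y / 2))))
    (Real.abs_cos_le_one (j * (x / 2)))
  have h4 := abs_sin_nat_mul_le j (x / 2)
  have h5 := abs_sin_nat_mul_le l (y / 2)
  have h6 : |Real.sin (j * (x / 2)) * Real.cos (l * (y / 2))
    + Real.cos (j * (x / 2)) * Real.sin (l * (y / 2))| ≤ j * a + l * b := by linarith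
  have h7 := sq_le_sq' (by linarith [abs_nonneg (Real.sin (j * (x / 2)) * Real.cos (l * (y / 2))
    + Real.cos (j * (x / 2)) * Real.sin (l * (y / 2)))]) h6
  rw [sq_abs] at h7
  rw [ha, hb]
  have hj : (0 : ℝ) ≤ j := Nat.cast_nonneg _
  have hl : (0 : ℝ) ≤ l := Nat.cast_nonneg _
  nlinarith [mul_nonneg (mul_nonneg hj hl) (sq_nonneg (a - b))]

lemma phaseGap_combo_le (μ : Measure ℂ) [IsProbabilityMeasure μ] (j l : ℕ) (x y : ℂ) :
    phaseGap μ (j * x + l * y) ≤ (j + l) * (j * phaseGap μ x + l * phaseGap μ y) := by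
  simp only [phaseGap_eq_integral]
  rw [← integral_const_mul, ← integral_const_mul, ← integral_add, ← integral_const_mul]
  · refine integral_mono (integrable_one_sub_cos μ _) ?_ ?_
    · exact (((integrable_one_sub_cos μ _).const_mul _).add
        ((integrable_one_sub_cos μ _).const_mul _)).const_mul _
    · intro z
      have := one_sub_cos_combo_le j l ((x * (z.1 - z.2)).re) ((y * (z.1 - z.2)).re)
      have e : ((j * x + l * y) * (z.1 - z.2)).re
          = j * ((x * (z.1 - z.2)).re) + l * ((y * (z.1 - z.2)).re) := by
        simp
        ring
      simpa only [e] using this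
  · exact (integrable_one_sub_cos μ _).const_mul _
  · exact (integrable_one_sub_cos μ _).const_mul _

lemma phaseGap_add_le (μ : Measure ℂ) [IsProbabilityMeasure μ] (x y : ℂ) :
    phaseGap μ (x + y) ≤ 2 * (phaseGap μ x + phaseGap μ y) := by
  have := phaseGap_combo_le μ 1 1 x y
  norm_num at this ⊢
  linarith

lemma phaseGap_le_norm_sq (μ : Measure ℂ) [IsProbabilityMeasure μ] {κ : ℝ}
    (hint : Integrable (fun a : ℂ => ‖a‖ ^ 2) μ) (hκ : ∫ a, ‖a‖ ^ 2 ∂μ ≤ κ) (w : ℂ) :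
    phaseGap μ w ≤ 2 * κ * ‖w‖ ^ 2 := by
  rw [phaseGap_eq_integral]
  have h1 : Integrable (fun z : ℂ × ℂ => ‖z.1‖ ^ 2) (μ.prod μ) := hint.comp_fst μ
  have h2 : Integrable (fun z : ℂ × ℂ => ‖z.2‖ ^ 2) (μ.prod μ) := hint.comp_snd μ
  have h3 : ∫ z : ℂ × ℂ, ‖w‖ ^ 2 * (‖z.1‖ ^ 2 + ‖z.2‖ ^ 2) ∂(μ.prod μ)
      = ‖w‖ ^ 2 * (∫ a, ‖a‖ ^ 2 ∂μ + ∫ a, ‖a‖ ^ 2 ∂μ) := by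
    rw [integral_const_mul, integral_add h1 h2]
    congr 2
    · rw [integral_fun_fst (f := fun a : ℂ => ‖a‖ ^ 2)]; simp
    · rw [integral_fun_snd (f := fun a : ℂ => ‖a‖ ^ 2)]; simp
  calc _ ≤ ∫ z : ℂ × ℂ, ‖w‖ ^ 2 * (‖z.1‖ ^ 2 + ‖z.2‖ ^ 2) ∂(μ.prod μ) := by
        refine integral_mono (integrable_one_sub_cos μ w) ((h1.add h2).const_mul _) ?_
        intro z
        have a1 := Real.one_sub_sq_div_two_le_cos (x := (w * (z.1 - z.2)).re)
        have a2 : ((w * (z.1 - z.2)).re) ^ 2 ≤ ‖w‖ ^ 2 * ‖z.1 - z.2‖ ^ 2 := by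
          rw [← mul_pow, ← norm_mul]
          exact sq_le_sq' (by linarith [(abs_le.1 (Complex.abs_re_le_norm (w * (z.1 - z.2)))).1])
            (Complex.re_le_norm _)
        have a3 : ‖z.1 - z.2‖ ^ 2 ≤ 2 * (‖z.1‖ ^ 2 + ‖z.2‖ ^ 2) := by
          nlinarith [norm_sub_le z.1 z.2, norm_nonneg (z.1 - z.2), sq_nonneg (‖z.1‖ - ‖z.2‖),
            norm_nonneg z.1, norm_nonneg z.2]
        have a4 := mul_le_mul_of_nonneg_left a3 (sq_nonneg ‖w‖)
        simp only
        linarith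
    _ ≤ 2 * κ * ‖w‖ ^ 2 := by
        rw [h3]
        nlinarith [sq_nonneg ‖w‖]

/-! ### Nondegeneracy of the symmetrisation -/

lemma sq_norm_sub_nondegenerate (μ : Measure ℂ) [IsProbabilityMeasure μ] {κ : ℝ} (hκ : 1 ≤ κ)
    (hvar : ∀ z w : ℂ, z.re ^ 2 / κ ≤ ∫ a in {a | ‖a‖ ≤ κ}, ((z * a - w).re) ^ 2 ∂μ) :
    1 / (8 * κ ^ 6) ≤
      (μ.prod μ).real {z : ℂ × ℂ | 1 / (2 * κ ^ 4) ≤ ‖z.1 - z.2‖ ^ 2 ∧ ‖z.1 - z.2‖ ≤ 2 * κ} := by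
  set K : Set ℂ := {a | ‖a‖ ≤ κ} with hK
  have hKm : MeasurableSet K := measurableSet_le measurable_norm measurable_const
  set D : Set (ℂ × ℂ) := {z | 1 / (2 * κ ^ 4) ≤ ‖z.1 - z.2‖ ^ 2 ∧ ‖z.1 - z.2‖ ≤ 2 * κ} with hD
  have hDm : MeasurableSet D := by
    refine MeasurableSet.inter ?_ ?_
    · exact measurableSet_le measurable_const ((measurable_fst.sub measurable_snd).norm.pow_const 2)
    · exact measurableSet_le (measurable_fst.sub measurable_snd).norm measurable_const
  have hκ0 : 0 < κ := by linarith
  -- mass of the disk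
  have hmass : 1 / κ ^ 3 ≤ μ.real K := by
    have h1 := hvar 1 0
    have h2 : ∫ a in K, ((1 * a - 0 : ℂ).re) ^ 2 ∂μ ≤ ∫ a in K, κ ^ 2 ∂μ := by
      refine setIntegral_mono_on ?_ (integrable_const _).integrableOn hKm ?_
      · refine Measure.integrableOn_of_bounded (M := κ ^ 2) (by simp) ?_ ?_
        · exact Continuous.aestronglyMeasurable (by
            have := Complex.continuous_re; fun_prop)
        · refine (ae_restrict_iff' hKm).2 ?_
          filter_upwards with a ha
          rw [Real.norm_eq_abs, abs_of_nonneg (sq_nonneg _), one_mul, sub_zero]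
          have := Complex.abs_re_le_norm a
          exact sq_le_sq' (by linarith [(abs_le.1 this).1, ha.out])
            ((Complex.re_le_norm a).trans ha)
      · intro a ha
        rw [one_mul, sub_zero]
        have := Complex.abs_re_le_norm a
        exact sq_le_sq' (by linarith [(abs_le.1 this).1, ha.out])
            ((Complex.re_le_norm a).trans ha)
    rw [setIntegral_const, smul_eq_mul] at h2
    simp only [Complex.one_re, one_pow] at h1
    have h3 : 1 / κ ≤ μ.real K * κ ^ 2 := h1.trans h2
    rw [div_le_iff₀ (by positivity)] at h3 ⊢
    nlinarith
  set f : ℂ × ℂ → ℝ := fun z => ((z.1 - z.2).re) ^ 2 with hf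
  have hfc : Continuous f := by
    have := Complex.continuous_re; fun_prop
  have hfb : ∀ z ∈ K ×ˢ K, f z ≤ ‖z.1 - z.2‖ ^ 2 ∧ ‖z.1 - z.2‖ ≤ 2 * κ := by
    rintro z ⟨h1, h2⟩
    refine ⟨?_, ?_⟩
    · have := Complex.abs_re_le_norm (z.1 - z.2)
      exact sq_le_sq' (by linarith [(abs_le.1 this).1]) (Complex.re_le_norm _)
    · have := norm_sub_le z.1 z.2
      have h1' : ‖z.1‖ ≤ κ := h1
      have h2' : ‖z.2‖ ≤ κ := h2
      linarith
  have hfb' : ∀ z ∈ K ×ˢ K, f z ≤ 4 * κ ^ 2 := by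
    intro z hz
    obtain ⟨h1, h2⟩ := hfb z hz
    nlinarith [norm_nonneg (z.1 - z.2)]
  have hfint : IntegrableOn f (K ×ˢ K) (μ.prod μ) := by
    refine Measure.integrableOn_of_bounded (M := 4 * κ ^ 2) (measure_ne_top _ _)
      hfc.aestronglyMeasurable ?_
    refine (ae_restrict_iff' (hKm.prod hKm)).2 ?_
    filter_upwards with z hz
    rw [Real.norm_eq_abs, abs_of_nonneg (sq_nonneg _)]
    exact hfb' z hz
  have hlow : 1 / κ ^ 4 ≤ ∫ z in K ×ˢ K, f z ∂(μ.prod μ) := by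
    rw [← Measure.prod_restrict] at *
    rw [IntegrableOn, ← Measure.prod_restrict] at hfint
    rw [integral_prod_symm _ hfint]
    have h1 : ∫ b in K, (1 / κ) ∂μ ≤ ∫ b in K, (∫ a in K, f (a, b) ∂μ) ∂μ := by
      refine integral_mono (integrable_const _) hfint.integral_prod_right ?_
      intro b
      have := hvar 1 b
      simpa [hf] using this
    rw [setIntegral_const, smul_eq_mul] at h1
    refine le_trans ?_ h1
    calc 1 / κ ^ 4 = 1 / κ ^ 3 * (1 / κ) := by field_simp
      _ ≤ _ := mul_le_mul_of_nonneg_right hmass (by positivity)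
  have hup : ∫ z in K ×ˢ K, f z ∂(μ.prod μ)
      ≤ ∫ z, (1 / (2 * κ ^ 4) + D.indicator (fun _ => 4 * κ ^ 2) z) ∂(μ.prod μ) := by
    rw [← integral_indicator (hKm.prod hKm)]
    refine integral_mono (hfint.integrable_indicator (hKm.prod hKm)) ?_ ?_
    · exact (integrable_const _).add ((integrable_const _).indicator hDm)
    · intro z
      by_cases hz : z ∈ K ×ˢ K
      · simp only [Set.indicator_of_mem hz]
        by_cases hzD : z ∈ D
        · simp only [Set.indicator_of_mem hzD]
          have := hfb' z hz
          have : 0 < 1 / (2 * κ ^ 4) := by positivity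
          linarith
        · simp only [Set.indicator_of_notMem hzD, add_zero]
          obtain ⟨h1, h2⟩ := hfb z hz
          by_contra hcon
          exact hzD ⟨(not_le.1 hcon).le.trans h1, h2⟩
      · simp only [Set.indicator_of_notMem hz]
        refine add_nonneg (by positivity) (Set.indicator_nonneg (fun _ _ => by positivity) _)
  rw [integral_add (integrable_const _) ((integrable_const _).indicator hDm),
    integral_indicator hDm, setIntegral_const, integral_const] at hup
  simp only [probReal_univ, smul_eq_mul, one_mul] at hup
  have h := hlow.trans hup
  have e : 1 / κ ^ 4 = 2 * (1 / (2 * κ ^ 4)) := by field_simp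
  have h4 : 1 / (2 * κ ^ 4) ≤ (μ.prod μ).real D * (4 * κ ^ 2) := by linarith
  calc 1 / (8 * κ ^ 6) = 1 / (2 * κ ^ 4) / (4 * κ ^ 2) := by field_simp; ring
    _ ≤ _ := by rw [div_le_iff₀ (by positivity)]; exact h4

/-! ### A discrete test measure on the plane -/

/-- Binomial weights on `{0, …, L}`. -/
noncomputable def binWeight (L : ℕ) (j : Fin (L + 1)) : ℝ := (L.choose j : ℝ) / 2 ^ L

/-- Centred and rescaled binomial atoms. -/
noncomputable def binPoint (L : ℕ) (j : Fin (L + 1)) : ℝ := ((L : ℝ) - 2 * (j : ℕ)) / √L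

lemma binWeight_nonneg (L : ℕ) (j : Fin (L + 1)) : 0 ≤ binWeight L j := by
  unfold binWeight; positivity

lemma sum_binWeight_exp (L : ℕ) (c : ℂ) :
    ∑ j, (binWeight L j : ℂ) * Complex.exp (c * binPoint L j) = Complex.cosh (c / √L) ^ L := by
  rw [Complex.cosh, div_pow, add_comm (Complex.exp _), add_pow, Finset.sum_div, Finset.sum_range]
  refine Finset.sum_congr rfl fun j _ => ?_
  have hj : (j : ℕ) ≤ L := Nat.lt_succ_iff.1 j.2
  rw [← Complex.exp_nat_mul, ← Complex.exp_nat_mul, ← Complex.exp_add, binWeight, binPoint]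
  push_cast [Nat.cast_sub hj]
  rw [show c * (((L : ℂ) - 2 * (j : ℕ)) / (√L : ℝ)) =
    (j : ℕ) * -(c / (√L : ℝ)) + ((L : ℂ) - (j : ℕ)) * (c / (√L : ℝ)) by ring]
  ring

lemma sum_binWeight (L : ℕ) : ∑ j, binWeight L j = 1 := by
  have := sum_binWeight_exp L 0
  simp only [zero_mul, Complex.exp_zero, mul_one, zero_div, Complex.cosh_zero, one_pow] at this
  exact_mod_cast this

lemma sum_binWeight_rexp (L : ℕ) (c : ℝ) :
    ∑ j, binWeight L j * Real.exp (c * binPoint L j) = Real.cosh (c / √L) ^ L := by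
  have := sum_binWeight_exp L c
  exact_mod_cast this

lemma binWeight_tail (L : ℕ) (hL : 0 < L) {R : ℝ} (hR : 0 ≤ R) :
    ∑ j with R < |binPoint L j|, binWeight L j ≤ 2 * Real.exp (-R ^ 2 / 2) := by
  have hcosh : Real.cosh (R / √L) ^ L ≤ Real.exp (R ^ 2 / 2) := by
    calc Real.cosh (R / √L) ^ L ≤ Real.exp ((R / √L) ^ 2 / 2) ^ L :=
          pow_le_pow_left₀ (Real.cosh_pos _).le (Real.cosh_le_exp_half_sq _) _
      _ = Real.exp (R ^ 2 / 2) := by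
          rw [← Real.exp_nat_mul, div_pow, Real.sq_sqrt (Nat.cast_nonneg _)]
          congr 1
          have : (L : ℝ) ≠ 0 := by positivity
          field_simp
  have h1 := sum_binWeight_rexp L R
  have h2 := sum_binWeight_rexp L (-R)
  rw [neg_div, Real.cosh_neg] at h2
  calc ∑ j with R < |binPoint L j|, binWeight L j
      ≤ ∑ j, binWeight L j * (Real.exp (R * binPoint L j) + Real.exp (-R * binPoint L j))
          * Real.exp (-R ^ 2) := by
        rw [Finset.sum_filter]
        refine Finset.sum_le_sum fun j _ => ?_
        have hw := binWeight_nonneg L j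
        split_ifs with h
        · rw [mul_assoc]
          refine le_mul_of_one_le_right hw ?_
          rw [add_mul, ← Real.exp_add, ← Real.exp_add]
          rcases lt_abs.1 h with h' | h'
          · have : 1 ≤ Real.exp (R * binPoint L j + -R ^ 2) := Real.one_le_exp (by nlinarith)
            linarith [Real.exp_pos (-R * binPoint L j + -R ^ 2)]
          · have : 1 ≤ Real.exp (-R * binPoint L j + -R ^ 2) := Real.one_le_exp (by nlinarith)
            linarith [Real.exp_pos (R * binPoint L j + -R ^ 2)]
        · positivity
    _ = 2 * Real.cosh (R / √L) ^ L * Real.exp (-R ^ 2) := by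
        rw [← Finset.sum_mul]
        simp only [mul_add]
        rw [Finset.sum_add_distrib, h1, h2]
        ring
    _ ≤ 2 * Real.exp (R ^ 2 / 2) * Real.exp (-R ^ 2) := by gcongr
    _ = 2 * Real.exp (-R ^ 2 / 2) := by
        rw [mul_assoc, ← Real.exp_add]
        congr 2
        ring

/-- Weights of the planar test measure. -/
noncomputable def testWeight (L : ℕ) (j : Fin (L + 1) × Fin (L + 1)) : ℝ :=
  binWeight L j.1 * binWeight L j.2

/-- Atoms of the planar test measure. -/
noncomputable def testPoint (L : ℕ) (j : Fin (L + 1) × Fin (L + 1)) : ℂ :=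
  ⟨binPoint L j.1, binPoint L j.2⟩

/-- Characteristic function of the planar test measure. -/
noncomputable def testChar (L : ℕ) (y : ℂ) : ℝ :=
  (Real.cos (y.re / √L) * Real.cos (y.im / √L)) ^ L

lemma testWeight_nonneg (L : ℕ) (j : Fin (L + 1) × Fin (L + 1)) : 0 ≤ testWeight L j :=
  mul_nonneg (binWeight_nonneg _ _) (binWeight_nonneg _ _)

lemma sum_testWeight (L : ℕ) : ∑ j, testWeight L j = 1 := by
  simp only [testWeight, Fintype.sum_prod_type]
  rw [← Finset.sum_mul_sum, sum_binWeight, one_mul]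

lemma sum_testWeight_exp (L : ℕ) (y : ℂ) :
    ∑ j, (testWeight L j : ℂ) * Complex.exp (((testPoint L j * y).re : ℝ) * Complex.I)
      = testChar L y := by
  have h1 := sum_binWeight_exp L (y.re * Complex.I)
  have h2 := sum_binWeight_exp L (-y.im * Complex.I)
  have e1 : Complex.cosh (y.re * Complex.I / (√L : ℝ)) = Real.cos (y.re / √L) := by
    rw [mul_div_right_comm, Complex.cosh_mul_I]; push_cast; rfl
  have e2 : Complex.cosh (-y.im * Complex.I / (√L : ℝ)) = Real.cos (y.im / √L) := by
    rw [mul_div_right_comm, Complex.cosh_mul_I, neg_div, Complex.cos_neg]; push_cast; rfl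
  rw [e1] at h1
  rw [e2] at h2
  rw [testChar, mul_pow]
  push_cast at h1 h2 ⊢
  rw [← h1, ← h2, Finset.sum_mul_sum, Fintype.sum_prod_type]
  refine Finset.sum_congr rfl fun i _ => Finset.sum_congr rfl fun j _ => ?_
  rw [mul_mul_mul_comm, ← Complex.exp_add]
  simp only [testWeight, testPoint, Complex.mul_re]
  push_cast
  congr 2
  ring

lemma sum_testWeight_cos (L : ℕ) (y : ℂ) :
    ∑ j, testWeight L j * Real.cos ((testPoint L j * y).re) = testChar L y := by
  have := congrArg Complex.re (sum_testWeight_exp L y)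
  simpa only [Complex.re_sum, Complex.re_ofReal_mul, Complex.exp_ofReal_mul_I_re,
    Complex.ofReal_re] using this

lemma testChar_nonneg {L : ℕ} (hL : Even L) (y : ℂ) : 0 ≤ testChar L y := hL.pow_nonneg _

lemma quarter_le_testChar {L : ℕ} (hL : 0 < L) {y : ℂ} (hy : ‖y‖ ≤ 1) : 1 / 4 ≤ testChar L y := by
  have key : ∀ t : ℝ, |t| ≤ 1 → 1 / 2 ≤ Real.cos (t / √L) ^ L := by
    intro t ht
    have ht2 : t ^ 2 ≤ 1 := by
      rw [← sq_abs]; exact pow_le_one₀ (abs_nonneg _) ht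
    have hL1 : (1 : ℝ) ≤ L := by exact_mod_cast hL
    have h1 := Real.one_sub_sq_div_two_le_cos (x := t / √L)
    rw [div_pow, Real.sq_sqrt (Nat.cast_nonneg _)] at h1
    have h3 : t ^ 2 / L ≤ 1 := by
      rw [div_le_one (by positivity)]; linarith
    have h2 := one_add_mul_le_pow (a := -(t ^ 2 / L / 2)) (by linarith) L
    have h4 : (L : ℝ) * -(t ^ 2 / L / 2) = - t ^ 2 / 2 := by field_simp
    rw [h4] at h2
    calc (1 : ℝ) / 2 ≤ (1 + -(t ^ 2 / L / 2)) ^ L := by linarith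
      _ ≤ _ := pow_le_pow_left₀ (by linarith) (by linarith) _
  rw [testChar, mul_pow]
  have h1 := key y.re ((Complex.abs_re_le_norm y).trans hy)
  have h2 := key y.im ((Complex.abs_im_le_norm y).trans hy)
  nlinarith

lemma testChar_le {L : ℕ} (hL : 0 < L) {y : ℂ} (hy : ‖y‖ ≤ √L) :
    testChar L y ≤ Real.exp (-‖y‖ ^ 2 / 4) := by
  have key : ∀ t : ℝ, |t| ≤ √L → 0 ≤ Real.cos (t / √L) ∧
      Real.cos (t / √L) ^ L ≤ Real.exp (-t ^ 2 / 4) := by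
    intro t ht
    have hs : 0 < √(L : ℝ) := Real.sqrt_pos.2 (by exact_mod_cast hL)
    have h1 : |t / √L| ≤ 1 := by
      rw [abs_div, abs_of_pos hs, div_le_one hs]; exact ht
    have h0 : 0 ≤ Real.cos (t / √L) := by
      have := Real.one_sub_sq_div_two_le_cos (x := t / √L)
      have h2 : (t / √L) ^ 2 ≤ 1 := by
        rw [← sq_abs]; exact pow_le_one₀ (abs_nonneg _) h1
      linarith
    refine ⟨h0, ?_⟩
    have h2 := (abs_le.1 (Real.cos_bound h1)).2
    have h3 : |t / √L| ^ 4 ≤ (t / √L) ^ 2 := by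
      have : |t / √L| ^ 4 = (t / √L) ^ 2 * (t / √L) ^ 2 := by
        rw [show (4 : ℕ) = 2 + 2 from rfl, pow_add, sq_abs]
      rw [this]
      have h2 : (t / √L) ^ 2 ≤ 1 := by
        rw [← sq_abs]; exact pow_le_one₀ (abs_nonneg _) h1
      nlinarith [sq_nonneg (t / √L)]
    have h4 : Real.cos (t / √L) ≤ Real.exp (-(t / √L) ^ 2 / 4) := by
      have := Real.add_one_le_exp (-(t / √L) ^ 2 / 4)
      nlinarith [sq_nonneg (t / √L)]
    calc Real.cos (t / √L) ^ L ≤ Real.exp (-(t / √L) ^ 2 / 4) ^ L := pow_le_pow_left₀ h0 h4 _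
      _ = Real.exp (-t ^ 2 / 4) := by
        rw [← Real.exp_nat_mul, div_pow, Real.sq_sqrt (Nat.cast_nonneg _)]
        congr 1
        have : (L : ℝ) ≠ 0 := by positivity
        field_simp
  obtain ⟨a1, a2⟩ := key y.re ((Complex.abs_re_le_norm y).trans hy)
  obtain ⟨b1, b2⟩ := key y.im ((Complex.abs_im_le_norm y).trans hy)
  rw [testChar, mul_pow]
  calc _ ≤ Real.exp (-y.re ^ 2 / 4) * Real.exp (-y.im ^ 2 / 4) :=
        mul_le_mul a2 b2 (pow_nonneg b1 _) (Real.exp_pos _).le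
    _ = _ := by
        rw [← Real.exp_add, ← Complex.normSq_eq_norm_sq, Complex.normSq_apply]
        congr 1
        ring

lemma testWeight_tail (L : ℕ) (hL : 0 < L) {R : ℝ} (hR : 0 ≤ R) :
    ∑ j with 2 * R < ‖testPoint L j‖, testWeight L j ≤ 4 * Real.exp (-R ^ 2 / 2) := by
  have ht := binWeight_tail L hL hR
  set t := ∑ j with R < |binPoint L j|, binWeight L j with htdef
  have e1 : ∑ j : Fin (L + 1) × Fin (L + 1) with R < |binPoint L j.1|, testWeight L j = t := by
    rw [Finset.sum_filter, Fintype.sum_prod_type, htdef, Finset.sum_filter]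
    refine Finset.sum_congr rfl fun i _ => ?_
    simp only [testWeight]
    split_ifs
    · rw [← Finset.mul_sum, sum_binWeight, mul_one]
    · simp
  have e2 : ∑ j : Fin (L + 1) × Fin (L + 1) with R < |binPoint L j.2|, testWeight L j = t := by
    rw [Finset.sum_filter, Fintype.sum_prod_type_right, htdef, Finset.sum_filter]
    refine Finset.sum_congr rfl fun i _ => ?_
    simp only [testWeight]
    split_ifs
    · rw [← Finset.sum_mul, sum_binWeight, one_mul]
    · simp
  have h : ∑ j with 2 * R < ‖testPoint L j‖, testWeight L j ≤
      ∑ j : Fin (L + 1) × Fin (L + 1) with R < |binPoint L j.1|, testWeight L j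
      + ∑ j : Fin (L + 1) × Fin (L + 1) with R < |binPoint L j.2|, testWeight L j := by
    rw [Finset.sum_filter, Finset.sum_filter, Finset.sum_filter, ← Finset.sum_add_distrib]
    refine Finset.sum_le_sum fun j _ => ?_
    have hw := testWeight_nonneg L j
    have hn : ‖testPoint L j‖ ≤ |binPoint L j.1| + |binPoint L j.2| :=
      Complex.norm_le_abs_re_add_abs_im _
    split_ifs <;> linarith
  linarith

/-! ### An Esseen-type inequality -/

lemma integral_pi_phase {ι : Type*} [Fintype ι] (μ : Measure ℂ) [IsProbabilityMeasure μ]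
    (v : ι → ℂ) (z ξ : ℂ) :
    ‖∫ x, Complex.exp (((ξ * (∑ i, v i * x i - z)).re : ℝ) * Complex.I)
      ∂(Measure.pi fun _ : ι => μ)‖ ≤ Real.exp (-(∑ i, phaseGap μ (v i * ξ)) / 2) := by
  have h1 : ∀ x : ι → ℂ, Complex.exp (((ξ * (∑ i, v i * x i - z)).re : ℝ) * Complex.I)
      = Complex.exp ((-(ξ * z).re : ℝ) * Complex.I)
        * ∏ i, Complex.exp ((((v i * ξ) * x i).re : ℝ) * Complex.I) := by
    intro x
    rw [← Complex.exp_sum, ← Complex.exp_add, ← Finset.sum_mul, ← add_mul,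
      ← Complex.ofReal_sum, ← Complex.ofReal_add]
    congr 3
    rw [mul_sub, Complex.sub_re, Finset.mul_sum, Complex.re_sum, sub_eq_neg_add]
    congr 1
    refine Finset.sum_congr rfl fun i _ => ?_
    congr 1
    ring
  simp only [h1]
  rw [integral_const_mul, norm_mul, Complex.norm_exp_ofReal_mul_I, one_mul,
    integral_fintype_prod_eq_prod (μ := fun _ : ι => μ)
      (f := fun i a => Complex.exp ((((v i * ξ) * a).re : ℝ) * Complex.I)),
    norm_prod, ← Finset.sum_neg_distrib, Finset.sum_div, Real.exp_sum]
  exact Finset.prod_le_prod (fun _ _ => norm_nonneg _) fun i _ => norm_charInt_le_exp μ _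

lemma smallBall_le {ι : Type*} [Fintype ι] (μ : Measure ℂ) [IsProbabilityMeasure μ]
    (v : ι → ℂ) {β : ℝ} (hβ : 0 < β) {L : ℕ} (hL : 0 < L) (hLe : Even L) :
    smallBall μ v β ≤
      4 * ∑ j, testWeight L j * Real.exp (-(∑ i, phaseGap μ (v i / β * testPoint L j)) / 2) := by
  refine ciSup_le fun z => ?_
  set P := Measure.pi fun _ : ι => μ
  set y : (ι → ℂ) → ℂ := fun x => (∑ i, v i / β * x i) - z / β with hy
  have hyeq : ∀ x, y x = (∑ i, v i * x i - z) / β := by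
    intro x
    simp only [hy, sub_div, Finset.sum_div]
    congr 1
    exact Finset.sum_congr rfl fun i _ => by ring
  have hyc : Continuous y := by fun_prop
  have hβ' : (β : ℂ) ≠ 0 := by exact_mod_cast hβ.ne'
  have hint : ∀ j, Integrable (fun x => (testWeight L j : ℂ) *
      Complex.exp (((testPoint L j * y x).re : ℝ) * Complex.I)) P := by
    intro j
    refine Integrable.const_mul (Integrable.of_bound ?_ 1 ?_) _
    · have : Continuous fun x => (testPoint L j * y x).re :=
        Complex.continuous_re.comp (by fun_prop)
      exact Continuous.aestronglyMeasurable (by fun_prop)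
    · filter_upwards with a
      rw [Complex.norm_exp_ofReal_mul_I]
  have htc : Continuous (testChar L) := by
    have := Complex.continuous_re
    have := Complex.continuous_im
    unfold testChar
    fun_prop
  have htint : Integrable (fun x => 4 * testChar L (y x)) P := by
    refine Integrable.const_mul (Integrable.of_bound (htc.comp hyc).aestronglyMeasurable 1 ?_) _
    filter_upwards with x
    change |testChar L (y x)| ≤ 1
    rw [testChar, abs_pow, abs_mul]
    exact pow_le_one₀ (by positivity)
      (mul_le_one₀ (Real.abs_cos_le_one _) (abs_nonneg _) (Real.abs_cos_le_one _))
  have hmeas : MeasurableSet {x : ι → ℂ | dist (∑ i, v i * x i) z ≤ β} :=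
    measurableSet_le (Continuous.measurable (by fun_prop)) measurable_const
  have h1 : (P {x | dist (∑ i, v i * x i) z ≤ β}).toReal ≤ ∫ x, 4 * testChar L (y x) ∂P := by
    rw [← Measure.real, ← mul_one (P.real _), ← smul_eq_mul,
      ← setIntegral_const, ← integral_indicator hmeas]
    refine integral_mono ((integrable_const _).indicator hmeas) htint fun x => ?_
    refine Set.indicator_le' (g := fun x => 4 * testChar L (y x)) (fun x hx => ?_)
      (fun x _ => ?_) x
    · have : ‖y x‖ ≤ 1 := by
        rw [hyeq, norm_div, Complex.norm_of_nonneg hβ.le, div_le_one hβ, ← dist_eq_norm]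
        exact hx
      linarith [quarter_le_testChar hL this]
    · simpa using testChar_nonneg hLe (y x)
  refine h1.trans ?_
  rw [integral_const_mul]
  refine mul_le_mul_of_nonneg_left ?_ (by norm_num)
  have h2 : ((∫ x, testChar L (y x) ∂P : ℝ) : ℂ) = ∑ j, (testWeight L j : ℂ) *
      ∫ x, Complex.exp (((testPoint L j * y x).re : ℝ) * Complex.I) ∂P := by
    rw [← integral_complex_ofReal]
    simp_rw [← sum_testWeight_exp]
    rw [integral_finsetSum _ fun j _ => hint j]
    simp_rw [integral_const_mul]
  calc ∫ x, testChar L (y x) ∂P ≤ ‖((∫ x, testChar L (y x) ∂P : ℝ) : ℂ)‖ := by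
        rw [Complex.norm_real]; exact le_abs_self _
    _ ≤ ∑ j, ‖(testWeight L j : ℂ) *
          ∫ x, Complex.exp (((testPoint L j * y x).re : ℝ) * Complex.I) ∂P‖ := by
        rw [h2]; exact norm_sum_le _ _
    _ ≤ _ := by
        refine Finset.sum_le_sum fun j _ => ?_
        rw [norm_mul, Complex.norm_of_nonneg (testWeight_nonneg _ _)]
        exact mul_le_mul_of_nonneg_left
          (integral_pi_phase μ (fun i => v i / β) (z / β) (testPoint L j)) (testWeight_nonneg _ _)

/-! ### Finite selection and counting arguments -/

lemma exp_neg_le_one_sub_half {h : ℝ} (h0 : 0 ≤ h) (h1 : h ≤ 1) : Real.exp (-h) ≤ 1 - h / 2 := by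
  rw [Real.exp_neg]
  have h2 := Real.add_one_le_exp h
  calc (Real.exp h)⁻¹ ≤ (h + 1)⁻¹ := inv_anti₀ (by linarith) h2
    _ ≤ 1 - h / 2 := by
      rw [inv_le_iff_one_le_mul₀ (by linarith)]
      nlinarith

/-- Derandomised sampling: few points of `T` suffice to detect all elements of `Bad`. -/
lemma exists_sample {ι Γ : Type*} (wt : ι → ℝ) (T : Finset ι) (hwt : ∀ j ∈ T, 0 ≤ wt j)
    (hT : 0 < ∑ j ∈ T, wt j) (h : Γ → ι → ℝ) (h0 : ∀ w j, 0 ≤ h w j) (h1 : ∀ w j, h w j ≤ 1)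
    (Bad : Finset Γ) {θ : ℝ} (hBad : ∀ w ∈ Bad, θ * ∑ j ∈ T, wt j ≤ ∑ j ∈ T, wt j * h w j)
    (q : ℕ) :
    ∃ t : Fin q → ι, (∀ l, t l ∈ T) ∧
      ∑ w ∈ Bad, Real.exp (-∑ l, h w (t l)) ≤ Bad.card * Real.exp (-(q * θ) / 2) := by
  induction q with
  | zero => exact ⟨Fin.elim0, fun l => l.elim0, by simp⟩
  | succ q ih =>
    obtain ⟨t, htT, ht⟩ := ih
    set y : Γ → ℝ := fun w => Real.exp (-∑ l, h w (t l)) with hy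
    have hy0 : ∀ w, 0 ≤ y w := fun w => (Real.exp_pos _).le
    have hsum : ∑ j ∈ T, wt j * ∑ w ∈ Bad, y w * Real.exp (-h w j)
        ≤ ∑ j ∈ T, wt j * (Real.exp (-θ / 2) * ∑ w ∈ Bad, y w) := by
      calc ∑ j ∈ T, wt j * ∑ w ∈ Bad, y w * Real.exp (-h w j)
          = ∑ w ∈ Bad, y w * ∑ j ∈ T, wt j * Real.exp (-h w j) := by
            simp_rw [Finset.mul_sum]
            rw [Finset.sum_comm]
            exact Finset.sum_congr rfl fun _ _ => Finset.sum_congr rfl fun _ _ => by ring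
        _ ≤ ∑ w ∈ Bad, y w * (Real.exp (-θ / 2) * ∑ j ∈ T, wt j) := by
            refine Finset.sum_le_sum fun w hw => mul_le_mul_of_nonneg_left ?_ (hy0 w)
            calc ∑ j ∈ T, wt j * Real.exp (-h w j) ≤ ∑ j ∈ T, wt j * (1 - h w j / 2) :=
                  Finset.sum_le_sum fun j hj => mul_le_mul_of_nonneg_left
                    (exp_neg_le_one_sub_half (h0 w j) (h1 w j)) (hwt j hj)
              _ = ∑ j ∈ T, wt j - (∑ j ∈ T, wt j * h w j) / 2 := by
                  rw [Finset.sum_div, ← Finset.sum_sub_distrib]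
                  exact Finset.sum_congr rfl fun _ _ => by ring
              _ ≤ (-θ / 2 + 1) * ∑ j ∈ T, wt j := by linarith [hBad w hw]
              _ ≤ _ := mul_le_mul_of_nonneg_right (Real.add_one_le_exp _) hT.le
        _ = _ := by
            rw [← Finset.sum_mul, ← Finset.sum_mul]
            ring
    obtain ⟨j, hj, hle⟩ : ∃ j ∈ T, ∑ w ∈ Bad, y w * Real.exp (-h w j)
        ≤ Real.exp (-θ / 2) * ∑ w ∈ Bad, y w := by
      by_contra! hcon
      obtain ⟨j0, hj0, hne⟩ := Finset.exists_ne_zero_of_sum_ne_zero hT.ne'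
      have hpos : 0 < wt j0 := lt_of_le_of_ne (hwt j0 hj0) hne.symm
      refine absurd hsum (not_le.2 (Finset.sum_lt_sum (fun j hj =>
        mul_le_mul_of_nonneg_left (hcon j hj).le (hwt j hj)) ⟨j0, hj0, ?_⟩))
      exact mul_lt_mul_of_pos_left (hcon j0 hj0) hpos
    refine ⟨Fin.cons j t, ?_, ?_⟩
    · intro l
      refine Fin.cases ?_ (fun i => ?_) l
      · simpa using hj
      · simpa using htT i
    · calc ∑ w ∈ Bad, Real.exp (-∑ l, h w ((Fin.cons j t : Fin (q + 1) → ι) l))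
          = ∑ w ∈ Bad, y w * Real.exp (-h w j) := by
            refine Finset.sum_congr rfl fun w _ => ?_
            rw [Fin.sum_univ_succ]
            simp only [Fin.cons_zero, Fin.cons_succ, hy]
            rw [← Real.exp_add]
            congr 1
            ring
        _ ≤ Real.exp (-θ / 2) * (Bad.card * Real.exp (-(q * θ) / 2)) :=
            hle.trans (mul_le_mul_of_nonneg_left ht (Real.exp_pos _).le)
        _ = _ := by
            rw [mul_left_comm, ← Real.exp_add]
            congr 2
            push_cast
            ring

/-- A large-sieve type bound for the number of phases correlating with a set of weight `W`. -/
lemma card_le_of_correlation {ι Γ : Type*} [Fintype ι] (wt : ι → ℝ) (hwt : ∀ j, 0 ≤ wt j)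
    (T : Finset ι) (hT : 0 < ∑ j ∈ T, wt j) (A : Finset Γ) (ph : Γ → ι → ℝ) {K : ℝ}
    (hK0 : 0 ≤ K)
    (hcor : (∑ j ∈ T, wt j) * A.card / 2 ≤ ∑ w ∈ A, ∑ j ∈ T, wt j * Real.cos (ph w j))
    (hK : ∀ w ∈ A, ∑ w' ∈ A, ∑ j, wt j * Real.cos (ph w j - ph w' j)
      ≤ K + (∑ j ∈ T, wt j) / 8 * A.card) :
    (A.card : ℝ) * ∑ j ∈ T, wt j ≤ 8 * K := by
  set W := ∑ j ∈ T, wt j with hW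
  set N : ℝ := (A.card : ℝ) with hN
  have hN0 : 0 ≤ N := Nat.cast_nonneg _
  set c : ι → ℝ := fun j => ∑ w ∈ A, Real.cos (ph w j) with hc
  set s : ι → ℝ := fun j => ∑ w ∈ A, Real.sin (ph w j) with hs
  have h1 : ∑ w ∈ A, ∑ j ∈ T, wt j * Real.cos (ph w j) = ∑ j ∈ T, wt j * c j := by
    rw [Finset.sum_comm]
    simp only [hc, Finset.mul_sum]
  have h2 : (∑ j ∈ T, wt j * c j) ^ 2 ≤ W * ∑ j ∈ T, wt j * c j ^ 2 := by
    refine Finset.sum_sq_le_sum_mul_sum_of_sq_le_mul T (fun j _ => hwt j)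
      (fun j _ => mul_nonneg (hwt j) (sq_nonneg _)) fun j _ => le_of_eq (by ring)
  have h3 : ∑ j ∈ T, wt j * c j ^ 2 ≤ ∑ j, wt j * (c j ^ 2 + s j ^ 2) := by
    calc ∑ j ∈ T, wt j * c j ^ 2 ≤ ∑ j ∈ T, wt j * (c j ^ 2 + s j ^ 2) :=
          Finset.sum_le_sum fun j _ => mul_le_mul_of_nonneg_left
            (by linarith [sq_nonneg (s j)]) (hwt j)
      _ ≤ _ := Finset.sum_le_univ_sum_of_nonneg fun j => mul_nonneg (hwt j) (by positivity)
  have h4 : ∑ j, wt j * (c j ^ 2 + s j ^ 2)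
      = ∑ w ∈ A, ∑ w' ∈ A, ∑ j, wt j * Real.cos (ph w j - ph w' j) := by
    have : ∀ j, wt j * (c j ^ 2 + s j ^ 2)
        = ∑ w ∈ A, ∑ w' ∈ A, wt j * Real.cos (ph w j - ph w' j) := by
      intro j
      simp only [hc, hs, sq, Finset.sum_mul_sum, Real.cos_sub, Finset.sum_add_distrib,
        ← Finset.mul_sum, mul_add]
    simp_rw [this]
    rw [Finset.sum_comm]
    refine Finset.sum_congr rfl fun w _ => ?_
    rw [Finset.sum_comm]
  have h5 : ∑ j, wt j * (c j ^ 2 + s j ^ 2) ≤ N * (K + W / 8 * N) := by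
    rw [h4]
    calc _ ≤ ∑ w ∈ A, (K + W / 8 * N) := Finset.sum_le_sum hK
      _ = _ := by rw [Finset.sum_const, nsmul_eq_mul]
  rcases hN0.eq_or_lt with h0 | hpos
  · rw [← h0, zero_mul]
    positivity
  rw [h1] at hcor
  have h6 : (W * N / 2) ^ 2 ≤ W * (N * (K + W / 8 * N)) :=
    calc (W * N / 2) ^ 2 ≤ (∑ j ∈ T, wt j * c j) ^ 2 := pow_le_pow_left₀ (by positivity) hcor 2
      _ ≤ W * ∑ j ∈ T, wt j * c j ^ 2 := h2
      _ ≤ _ := mul_le_mul_of_nonneg_left (h3.trans h5) hT.le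
  have h7 : 0 < W * N := mul_pos hT hpos
  have h8 : W * N / 4 ≤ K + W / 8 * N := by
    refine le_of_mul_le_mul_left ?_ h7
    nlinarith
  linarith

/-! ### Lattice points with small average phase gap -/

/-- The point of the square lattice of mesh `s` with given integer coordinates. -/
noncomputable def latticePt (s : ℝ) (a : ℤ × ℤ) : ℂ := ⟨s * a.1, s * a.2⟩

lemma card_lattice_near_le {s r : ℝ} (hs : 0 < s) (hr : 0 ≤ r) (A : Finset (ℤ × ℤ)) (a : ℤ × ℤ) :
    ((A.filter fun b => ‖latticePt s a - latticePt s b‖ ≤ r).card : ℝ) ≤ (2 * r / s + 1) ^ 2 := by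
  set M : ℕ := ⌊r / s⌋₊ with hM
  have hrs : 0 ≤ r / s := by positivity
  have hsub : (A.filter fun b => ‖latticePt s a - latticePt s b‖ ≤ r) ⊆
      Finset.Icc (a.1 - M) (a.1 + M) ×ˢ Finset.Icc (a.2 - M) (a.2 + M) := by
    intro b hb
    have hb := (Finset.mem_filter.1 hb).2
    have key : ∀ x y : ℤ, |s * x - s * y| ≤ r → x - M ≤ y ∧ y ≤ x + M := by
      intro x y h
      rw [← mul_sub, abs_mul, abs_of_pos hs, ← le_div_iff₀' hs] at h
      have h' : ((x - y).natAbs : ℝ) ≤ r / s := by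
        rw [Nat.cast_natAbs]
        push_cast
        exact h
      have := Nat.le_floor h'
      omega
    have h1 := key a.1 b.1 ((Complex.abs_re_le_norm _).trans hb)
    have h2 := key a.2 b.2 ((Complex.abs_im_le_norm _).trans hb)
    simp only [Finset.mem_product, Finset.mem_Icc]
    exact ⟨h1, h2⟩
  have hcard := Finset.card_le_card hsub
  rw [Finset.card_product, Int.card_Icc, Int.card_Icc] at hcard
  have e : ∀ x : ℤ, (x + M + 1 - (x - M)).toNat = 2 * M + 1 := by intro x; omega
  rw [e, e, ← sq] at hcard
  have hM' : (M : ℝ) ≤ r / s := Nat.floor_le hrs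
  calc ((A.filter fun b => ‖latticePt s a - latticePt s b‖ ≤ r).card : ℝ)
      ≤ (((2 * M + 1) ^ 2 : ℕ) : ℝ) := by exact_mod_cast hcard
    _ = (2 * (M : ℝ) + 1) ^ 2 := by push_cast; rfl
    _ ≤ (2 * r / s + 1) ^ 2 := by
      refine pow_le_pow_left₀ (by positivity) ?_ 2
      rw [mul_div_assoc]
      linarith

lemma exists_direction (μ : Measure ℂ) [IsProbabilityMeasure μ] {κ : ℝ} (hκ : 1 ≤ κ)
    (hvar : ∀ z w : ℂ, z.re ^ 2 / κ ≤ ∫ a in {a | ‖a‖ ≤ κ}, ((z * a - w).re) ^ 2 ∂μ)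
    {ι Γ : Type*} (wt : ι → ℝ) (ξ : ι → ℂ) (T : Finset ι) (hwt : ∀ j ∈ T, 0 ≤ wt j)
    (A : Finset Γ) (pt : Γ → ℂ)
    (hA : ∀ a ∈ A, ∑ j ∈ T, wt j * phaseGap μ (pt a * ξ j) ≤ 1 / (16 * κ ^ 6) * ∑ j ∈ T, wt j) :
    ∃ d : ℂ, 1 / (2 * κ ^ 4) ≤ ‖d‖ ^ 2 ∧ ‖d‖ ≤ 2 * κ ∧
      (∑ j ∈ T, wt j) * A.card / 2 ≤
        ∑ a ∈ A, ∑ j ∈ T, wt j * Real.cos ((pt a * ξ j * d).re) := by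
  have hκ0 : 0 < κ := by linarith
  have hD := sq_norm_sub_nondegenerate μ hκ hvar
  set D : Set (ℂ × ℂ) :=
    {z : ℂ × ℂ | 1 / (2 * κ ^ 4) ≤ ‖z.1 - z.2‖ ^ 2 ∧ ‖z.1 - z.2‖ ≤ 2 * κ} with hDdef
  set H : ℂ × ℂ → ℝ := fun z =>
    ∑ a ∈ A, ∑ j ∈ T, wt j * (1 - Real.cos ((pt a * ξ j * (z.1 - z.2)).re)) with hH
  have hpos : 0 < (μ.prod μ).real D := lt_of_lt_of_le (by positivity) hD
  have hint : Integrable H (μ.prod μ) :=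
    integrable_finsetSum _ fun a _ => integrable_finsetSum _ fun j _ =>
      (integrable_one_sub_cos μ _).const_mul _
  have hH0 : ∀ z, 0 ≤ H z := fun z => Finset.sum_nonneg fun a _ => Finset.sum_nonneg fun j hj =>
    mul_nonneg (hwt j hj) (by linarith [Real.cos_le_one ((pt a * ξ j * (z.1 - z.2)).re)])
  have hHint : ∫ z, H z ∂(μ.prod μ) ≤ A.card * (1 / (16 * κ ^ 6) * ∑ j ∈ T, wt j) := by
    have e : ∫ z, H z ∂(μ.prod μ) = ∑ a ∈ A, ∑ j ∈ T, wt j * phaseGap μ (pt a * ξ j) := by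
      simp only [hH]
      rw [integral_finsetSum _ fun a _ => integrable_finsetSum _ fun j _ =>
        (integrable_one_sub_cos μ _).const_mul _]
      refine Finset.sum_congr rfl fun a _ => ?_
      rw [integral_finsetSum _ fun j _ => (integrable_one_sub_cos μ _).const_mul _]
      refine Finset.sum_congr rfl fun j _ => ?_
      rw [integral_const_mul, phaseGap_eq_integral]
    rw [e, ← nsmul_eq_mul]
    exact Finset.sum_le_card_nsmul _ _ _ hA
  obtain ⟨z, hz, hle⟩ := exists_le_setAverage (μ := μ.prod μ) (s := D) (f := H)
    (by intro h; rw [Measure.real, h] at hpos; simp at hpos) (measure_ne_top _ _)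
    hint.integrableOn
  refine ⟨z.1 - z.2, hz.1, hz.2, ?_⟩
  have hW : 0 ≤ ∑ j ∈ T, wt j := Finset.sum_nonneg hwt
  have h1 : H z ≤ (∑ j ∈ T, wt j) * A.card / 2 := by
    refine hle.trans ?_
    rw [setAverage_eq, smul_eq_mul, inv_mul_le_iff₀ hpos]
    calc ∫ z in D, H z ∂(μ.prod μ) ≤ ∫ z, H z ∂(μ.prod μ) :=
          setIntegral_le_integral hint (ae_of_all _ hH0)
      _ ≤ A.card * (1 / (16 * κ ^ 6) * ∑ j ∈ T, wt j) := hHint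
      _ = 1 / (8 * κ ^ 6) * ((∑ j ∈ T, wt j) * A.card / 2) := by
          field_simp
          ring
      _ ≤ _ := mul_le_mul_of_nonneg_right hD (by positivity)
  have h2 : H z = (∑ j ∈ T, wt j) * A.card
      - ∑ a ∈ A, ∑ j ∈ T, wt j * Real.cos ((pt a * ξ j * (z.1 - z.2)).re) := by
    simp only [hH, mul_sub, mul_one, Finset.sum_sub_distrib, Finset.sum_const, nsmul_eq_mul]
    ring
  linarith

lemma card_lattice_small_average_le (μ : Measure ℂ) [IsProbabilityMeasure μ] {κ : ℝ} (hκ : 1 ≤ κ)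
    (hvar : ∀ z w : ℂ, z.re ^ 2 / κ ≤ ∫ a in {a | ‖a‖ ≤ κ}, ((z * a - w).re) ^ 2 ∂μ)
    {L : ℕ} (hL : 0 < L) {s m : ℝ} (hs : 0 < s) (hm : 0 ≤ m)
    (T : Finset (Fin (L + 1) × Fin (L + 1))) (hT : 0 < ∑ j ∈ T, testWeight L j)
    (hexp : Real.exp (-m / 2) ≤ (∑ j ∈ T, testWeight L j) / 8) (A : Finset (ℤ × ℤ))
    (hdiam : ∀ a ∈ A, ∀ b ∈ A, ‖latticePt s a - latticePt s b‖ * (2 * κ) ≤ √L)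
    (hA : ∀ a ∈ A, ∑ j ∈ T, testWeight L j * phaseGap μ (latticePt s a * testPoint L j)
      ≤ 1 / (16 * κ ^ 6) * ∑ j ∈ T, testWeight L j) :
    (A.card : ℝ) * ∑ j ∈ T, testWeight L j ≤ 8 * (2 * (2 * κ ^ 2 * √m) / s + 1) ^ 2 := by
  have hκ0 : 0 < κ := by linarith
  obtain ⟨d, hd1, hd2, hcor⟩ := exists_direction μ hκ hvar (testWeight L) (testPoint L) T
    (fun j _ => testWeight_nonneg L j) A (latticePt s) hA
  refine card_le_of_correlation (testWeight L) (testWeight_nonneg L) T hT A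
    (fun a j => (latticePt s a * testPoint L j * d).re) (by positivity) hcor fun a ha => ?_
  have e : ∀ b, ∑ j, testWeight L j * Real.cos ((latticePt s a * testPoint L j * d).re
      - (latticePt s b * testPoint L j * d).re)
      = testChar L ((latticePt s a - latticePt s b) * d) := by
    intro b
    rw [← sum_testWeight_cos]
    refine Finset.sum_congr rfl fun j _ => ?_
    rw [← Complex.sub_re]
    congr 3
    ring
  simp only [e]
  set r := 2 * κ ^ 2 * √m with hr
  have hr0 : 0 ≤ r := by positivity
  have hle : ∀ b ∈ A, testChar L ((latticePt s a - latticePt s b) * d)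
      ≤ (if ‖latticePt s a - latticePt s b‖ ≤ r then 1 else 0)
        + (∑ j ∈ T, testWeight L j) / 8 := by
    intro b hb
    have h1 : ‖(latticePt s a - latticePt s b) * d‖ ≤ √L := by
      rw [norm_mul]
      exact (mul_le_mul_of_nonneg_left hd2 (norm_nonneg _)).trans (hdiam a ha b hb)
    refine (testChar_le hL h1).trans ?_
    split_ifs with h
    · have : Real.exp (-‖(latticePt s a - latticePt s b) * d‖ ^ 2 / 4) ≤ 1 := by
        rw [Real.exp_le_one_iff]
        nlinarith [sq_nonneg ‖(latticePt s a - latticePt s b) * d‖]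
      linarith
    · rw [zero_add]
      refine le_trans (Real.exp_le_exp.2 ?_) hexp
      push Not at h
      have h2 : r ^ 2 ≤ ‖latticePt s a - latticePt s b‖ ^ 2 := pow_le_pow_left₀ hr0 h.le 2
      have h3 : r ^ 2 * (1 / (2 * κ ^ 4)) ≤ ‖latticePt s a - latticePt s b‖ ^ 2 * ‖d‖ ^ 2 :=
        mul_le_mul h2 hd1 (by positivity) (by positivity)
      have h4 : r ^ 2 * (1 / (2 * κ ^ 4)) = 2 * m := by
        rw [hr, mul_pow, Real.sq_sqrt hm]
        field_simp
      rw [norm_mul, mul_pow]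
      linarith
  calc ∑ b ∈ A, testChar L ((latticePt s a - latticePt s b) * d)
      ≤ ∑ b ∈ A, ((if ‖latticePt s a - latticePt s b‖ ≤ r then 1 else 0)
        + (∑ j ∈ T, testWeight L j) / 8) := Finset.sum_le_sum hle
    _ = ((A.filter fun b => ‖latticePt s a - latticePt s b‖ ≤ r).card : ℝ)
        + (∑ j ∈ T, testWeight L j) / 8 * A.card := by
        rw [Finset.sum_add_distrib, Finset.sum_boole, Finset.sum_const, nsmul_eq_mul]
        ring
    _ ≤ _ := by
        gcongr
        exact card_lattice_near_le hs hr0 A a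

/-! ### Empirical phase gaps -/

/-- The average of the phase gap of `w` over a finite family of frequencies. -/
noncomputable def empGap (μ : Measure ℂ) {q : ℕ} (ξ : Fin q → ℂ) (w : ℂ) : ℝ :=
  (∑ l, phaseGap μ (w * ξ l)) / q

lemma empGap_nonneg (μ : Measure ℂ) [IsProbabilityMeasure μ] {q : ℕ} (ξ : Fin q → ℂ) (w : ℂ) :
    0 ≤ empGap μ ξ w :=
  div_nonneg (Finset.sum_nonneg fun _ _ => phaseGap_nonneg μ _) (Nat.cast_nonneg _)

lemma empGap_combo_le (μ : Measure ℂ) [IsProbabilityMeasure μ] {q : ℕ} (ξ : Fin q → ℂ)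
    (j l : ℕ) (x y : ℂ) :
    empGap μ ξ (j * x + l * y) ≤ (j + l) * (j * empGap μ ξ x + l * empGap μ ξ y) := by
  unfold empGap
  rw [mul_div_assoc', mul_div_assoc', ← add_div, mul_div_assoc', Finset.mul_sum, Finset.mul_sum,
    ← Finset.sum_add_distrib, Finset.mul_sum]
  gcongr with i
  rw [add_mul, mul_assoc, mul_assoc]
  exact phaseGap_combo_le μ j l _ _

lemma half_mass_le_level_set {ι : Type*} [Fintype ι] (μ : Measure ℂ) [IsProbabilityMeasure μ]
    (v : ι → ℂ) {β p m : ℝ} (hβ : 0 < β) (hm : 0 ≤ m) (hp : Real.exp (-m / 2) ≤ p / 64)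
    (hv : p ≤ smallBall μ v β) {L : ℕ} (hL : 0 < L) (hLe : Even L) :
    p / 8 ≤ ∑ j with (∑ i, phaseGap μ (v i / β * testPoint L j)) ≤ m
        ∧ ‖testPoint L j‖ ≤ 2 * √m, testWeight L j := by
  have h1 := smallBall_le μ v hβ hL hLe
  have h2 := testWeight_tail L hL (Real.sqrt_nonneg m)
  rw [Real.sq_sqrt hm] at h2
  set F : Fin (L + 1) × Fin (L + 1) → ℝ :=
    fun j => ∑ i, phaseGap μ (v i / β * testPoint L j) with hF
  have hF0 : ∀ j, 0 ≤ F j := fun j => Finset.sum_nonneg fun i _ => phaseGap_nonneg μ _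
  have h3 : ∑ j, testWeight L j * Real.exp (-F j / 2) ≤
      ∑ j with F j ≤ m ∧ ‖testPoint L j‖ ≤ 2 * √m, testWeight L j
      + ∑ j with 2 * √m < ‖testPoint L j‖, testWeight L j
      + ∑ j, testWeight L j * Real.exp (-m / 2) := by
    rw [Finset.sum_filter, Finset.sum_filter, ← Finset.sum_add_distrib, ← Finset.sum_add_distrib]
    refine Finset.sum_le_sum fun j _ => ?_
    have hw := testWeight_nonneg L j
    have h0 : 0 ≤ testWeight L j * Real.exp (-m / 2) := by positivity
    have he : testWeight L j * Real.exp (-F j / 2) ≤ testWeight L j :=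
      mul_le_of_le_one_right hw (by rw [Real.exp_le_one_iff]; linarith [hF0 j])
    by_cases hFm : F j ≤ m
    · by_cases hR : ‖testPoint L j‖ ≤ 2 * √m
      · rw [if_pos ⟨hFm, hR⟩, if_neg (not_lt.2 hR)]
        linarith
      · rw [if_neg (fun h => hR h.2), if_pos (not_le.1 hR)]
        linarith
    · have : testWeight L j * Real.exp (-F j / 2) ≤ testWeight L j * Real.exp (-m / 2) := by
        push Not at hFm
        gcongr
      rw [if_neg (fun h => hFm h.1)]
      split_ifs <;> linarith
  rw [← Finset.sum_mul, sum_testWeight, one_mul] at h3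
  have hp0 : 0 < p := by linarith [Real.exp_pos (-m / 2)]
  linarith

/-- Nearest point of the lattice of mesh `s`, in coordinates. -/
noncomputable def latticeRound (s : ℝ) (b : ℂ) : ℤ × ℤ := (round (b.re / s), round (b.im / s))

lemma norm_latticePt_round_sub_le {s : ℝ} (hs : 0 < s) (b : ℂ) :
    ‖latticePt s (latticeRound s b) - b‖ ≤ s := by
  have key : ∀ x : ℝ, |s * round (x / s) - x| ≤ s / 2 := by
    intro x
    have := abs_sub_round (x / s)
    have e : s * round (x / s) - x = -(s * (x / s - round (x / s))) := by
      field_simp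
      ring
    rw [e, abs_neg, abs_mul, abs_of_pos hs]
    nlinarith
  refine (Complex.norm_le_abs_re_add_abs_im _).trans ?_
  have h1 := key b.re
  have h2 := key b.im
  simp only [latticePt, latticeRound, Complex.sub_re, Complex.sub_im]
  linarith

lemma abs_round_div_le {s ρ x : ℝ} {M : ℕ} (hs : 0 < s) (hM : ρ / s + 1 ≤ M) (hx : |x| ≤ ρ) :
    |round (x / s)| ≤ M := by
  have h1 := abs_sub_round (x / s)
  have h2 : |x / s| ≤ ρ / s := by
    rw [abs_div, abs_of_pos hs]
    gcongr
  have h3 : |(round (x / s) : ℝ)| ≤ M := by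
    have := abs_sub_abs_le_abs_sub (round (x / s) : ℝ) (x / s)
    rw [abs_sub_comm] at this
    linarith
  exact_mod_cast h3

lemma norm_latticePt_sub_le {s : ℝ} (hs : 0 < s) {M : ℕ} {a b : ℤ × ℤ}
    (ha : a ∈ Finset.Icc (-(M : ℤ)) M ×ˢ Finset.Icc (-(M : ℤ)) M)
    (hb : b ∈ Finset.Icc (-(M : ℤ)) M ×ˢ Finset.Icc (-(M : ℤ)) M) :
    ‖latticePt s a - latticePt s b‖ ≤ 4 * s * M := by
  simp only [Finset.mem_product, Finset.mem_Icc] at ha hb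
  have key : ∀ x y : ℤ, -(M : ℤ) ≤ x ∧ x ≤ M → -(M : ℤ) ≤ y ∧ y ≤ M →
      |s * (x : ℝ) - s * y| ≤ s * (2 * M) := by
    intro x y hx hy
    rw [← mul_sub, abs_mul, abs_of_pos hs]
    refine mul_le_mul_of_nonneg_left ?_ hs.le
    have : |x - y| ≤ 2 * (M : ℤ) := by rw [abs_le]; omega
    exact_mod_cast this
  refine (Complex.norm_le_abs_re_add_abs_im _).trans ?_
  have h1 := key a.1 b.1 ha.1 hb.1
  have h2 := key a.2 b.2 ha.2 hb.2
  simp only [latticePt, Complex.sub_re, Complex.sub_im]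
  linarith

/-- A bounded number of frequencies witnesses the structure forced by a large small ball
probability: the empirical gap of the steps is small on average, while separated sets of points
with small empirical gap are small. -/
lemma exists_frequencies {ι : Type*} [Fintype ι] (μ : Measure ℂ) [IsProbabilityMeasure μ] {κ : ℝ}
    (hκ : 1 ≤ κ) (hint : Integrable (fun a : ℂ => ‖a‖ ^ 2) μ) (hmom : ∫ a, ‖a‖ ^ 2 ∂μ ≤ κ)
    (hvar : ∀ z w : ℂ, z.re ^ 2 / κ ≤ ∫ a in {a | ‖a‖ ≤ κ}, ((z * a - w).re) ^ 2 ∂μ)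
    (v : ι → ℂ) {β p m : ℝ} (hβ : 0 < β) (hm : 0 ≤ m) (hp : Real.exp (-m / 2) ≤ p / 64)
    (hv : p ≤ smallBall μ v β) {L : ℕ} (hL : 0 < L) (hLe : Even L)
    {s θ ρ : ℝ} (hs : 0 < s) (hs4 : s < 1 / 4) (hθ : θ = 1 / (16 * κ ^ 6))
    (hsm : 256 * κ * m * s ^ 2 ≤ θ) {M q : ℕ} (hM : ρ / s + 1 ≤ M) (hML : 8 * κ * s * M ≤ √L)
    (hq : (2 * (M : ℝ) + 1) ^ 2 < Real.exp (q * θ / 4)) :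
    ∃ t : Fin q → Fin (L + 1) × Fin (L + 1),
      (∑ i, empGap μ (fun l => testPoint L (t l)) (v i / β)) ≤ m ∧
      ∀ B : Finset ℂ, (∀ b ∈ B, ‖b‖ ≤ ρ) →
        (∀ b ∈ B, empGap μ (fun l => testPoint L (t l)) b ≤ θ / 32) →
        (∀ b ∈ B, ∀ b' ∈ B, b ≠ b' → 1 / 2 ≤ ‖b - b'‖) →
        (B.card : ℝ) ≤ 64 * (4 * κ ^ 2 * √m / s + 1) ^ 2 / p := by
  have hκ0 : 0 < κ := by linarith
  have hp0 : 0 < p := by linarith [Real.exp_pos (-m / 2)]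
  have hθ0 : 0 < θ := by rw [hθ]; positivity
  have hmass := half_mass_le_level_set μ v hβ hm hp hv hL hLe
  set T : Finset (Fin (L + 1) × Fin (L + 1)) :=
    Finset.univ.filter fun j => (∑ i, phaseGap μ (v i / β * testPoint L j)) ≤ m
        ∧ ‖testPoint L j‖ ≤ 2 * √m with hTdef
  set W := ∑ j ∈ T, testWeight L j with hW
  have hW0 : 0 < W := by linarith
  have hq0 : 0 < q := by
    rcases Nat.eq_zero_or_pos q with rfl | h
    · simp only [Nat.cast_zero, zero_mul, zero_div, Real.exp_zero] at hq
      have : (0 : ℝ) ≤ M := Nat.cast_nonneg _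
      nlinarith
    · exact h
  have hq0' : (0 : ℝ) < q := by exact_mod_cast hq0
  set Γ : Finset (ℤ × ℤ) := Finset.Icc (-(M : ℤ)) M ×ˢ Finset.Icc (-(M : ℤ)) M with hΓ
  have hΓcard : (Γ.card : ℝ) = (2 * (M : ℝ) + 1) ^ 2 := by
    have : Γ.card = (2 * M + 1) ^ 2 := by
      have e : ((M : ℤ) + 1 - -(M : ℤ)).toNat = 2 * M + 1 := by omega
      rw [hΓ, Finset.card_product, Int.card_Icc, e, sq]
    rw [this]
    push_cast
    rfl
  set Bad := Γ.filter fun a =>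
    θ * W ≤ ∑ j ∈ T, testWeight L j * phaseGap μ (latticePt s a * testPoint L j) with hBad
  obtain ⟨t, htT, ht⟩ := exists_sample (testWeight L) T (fun j _ => testWeight_nonneg L j) hW0
    (fun a j => phaseGap μ (latticePt s a * testPoint L j)) (fun _ _ => phaseGap_nonneg μ _)
    (fun _ _ => phaseGap_le_one μ _) Bad (fun a ha => (Finset.mem_filter.1 ha).2) q
  have htm : ∀ l, (∑ i, phaseGap μ (v i / β * testPoint L (t l))) ≤ m ∧
      ‖testPoint L (t l)‖ ≤ 2 * √m := fun l => (Finset.mem_filter.1 (htT l)).2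
  refine ⟨t, ?_, fun B hBρ hBe hBs => ?_⟩
  · unfold empGap
    rw [← Finset.sum_div, Finset.sum_comm, div_le_iff₀ hq0']
    calc ∑ l, ∑ i, phaseGap μ (v i / β * testPoint L (t l)) ≤ ∑ _l : Fin q, m :=
          Finset.sum_le_sum fun l _ => (htm l).1
      _ = m * q := by simp [mul_comm]
  set A : Finset (ℤ × ℤ) := B.image (latticeRound s) with hA
  have hnear := norm_latticePt_round_sub_le hs
  have hinj : Set.InjOn (latticeRound s) B := by
    intro b hb b' hb' h
    by_contra hne
    have h1 := hBs b hb b' hb' hne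
    have h2 := hnear b
    have h3 := hnear b'
    rw [h] at h2
    have h4 : ‖b - b'‖ ≤ s + s := by
      calc ‖b - b'‖ = ‖(latticePt s (latticeRound s b') - b')
            - (latticePt s (latticeRound s b') - b)‖ := by congr 1; ring
        _ ≤ _ := (norm_sub_le _ _).trans (add_le_add h3 h2)
    linarith
  have hAΓ : A ⊆ Γ := by
    intro a ha
    obtain ⟨b, hb, rfl⟩ := Finset.mem_image.1 ha
    have h1 := abs_le.1 (abs_round_div_le hs hM ((Complex.abs_re_le_norm b).trans (hBρ b hb)))
    have h2 := abs_le.1 (abs_round_div_le hs hM ((Complex.abs_im_le_norm b).trans (hBρ b hb)))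
    simp only [hΓ, latticeRound, Finset.mem_product, Finset.mem_Icc]
    exact ⟨h1, h2⟩
  have hAgap : ∀ a ∈ A, ∑ l, phaseGap μ (latticePt s a * testPoint L (t l)) ≤ q * (θ / 8) := by
    intro a ha
    obtain ⟨b, hb, rfl⟩ := Finset.mem_image.1 ha
    have hb1 := hBe b hb
    rw [empGap, div_le_iff₀ hq0'] at hb1
    calc ∑ l, phaseGap μ (latticePt s (latticeRound s b) * testPoint L (t l))
        ≤ ∑ l, (2 * phaseGap μ (b * testPoint L (t l)) + θ / 16) := by
          refine Finset.sum_le_sum fun l _ => ?_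
          have h1 := phaseGap_add_le μ (b * testPoint L (t l))
            ((latticePt s (latticeRound s b) - b) * testPoint L (t l))
          rw [← add_mul, add_sub_cancel] at h1
          have h2 := phaseGap_le_norm_sq μ hint hmom
            ((latticePt s (latticeRound s b) - b) * testPoint L (t l))
          rw [norm_mul] at h2
          have h3 : (‖latticePt s (latticeRound s b) - b‖ * ‖testPoint L (t l)‖) ^ 2
              ≤ (s * (2 * √m)) ^ 2 := by
            refine pow_le_pow_left₀ (by positivity) ?_ 2
            exact mul_le_mul (hnear b) (htm l).2 (norm_nonneg _) hs.le
          have h4 : (s * (2 * √m)) ^ 2 = 4 * m * s ^ 2 := by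
            rw [mul_pow, mul_pow, Real.sq_sqrt hm]
            ring
          rw [h4] at h3
          have h5 : 2 * κ * (‖latticePt s (latticeRound s b) - b‖ * ‖testPoint L (t l)‖) ^ 2
              ≤ 2 * κ * (4 * m * s ^ 2) := mul_le_mul_of_nonneg_left h3 (by positivity)
          linarith
      _ = 2 * ∑ l, phaseGap μ (b * testPoint L (t l)) + q * (θ / 16) := by
          rw [Finset.sum_add_distrib, Finset.mul_sum]
          simp
      _ ≤ _ := by linarith
  have hAnotBad : ∀ a ∈ A, a ∉ Bad := by
    intro a ha hab
    have h1 : Real.exp (-(q * (θ / 8))) ≤ Bad.card * Real.exp (-(q * θ) / 2) := by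
      refine le_trans ?_ ht
      refine le_trans ?_ (Finset.single_le_sum (f := fun a =>
        Real.exp (-∑ l, phaseGap μ (latticePt s a * testPoint L (t l))))
        (fun _ _ => (Real.exp_pos _).le) hab)
      exact Real.exp_le_exp.2 (neg_le_neg (hAgap a ha))
    have h2 : (Bad.card : ℝ) ≤ Γ.card := by
      exact_mod_cast Finset.card_le_card (Finset.filter_subset _ _)
    have h3 : (Bad.card : ℝ) * Real.exp (-(q * θ) / 2)
        < Real.exp (q * θ / 4) * Real.exp (-(q * θ) / 2) :=
      mul_lt_mul_of_pos_right (by linarith) (Real.exp_pos _)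
    rw [← Real.exp_add] at h3
    have h4 := Real.exp_lt_exp.1 (lt_of_le_of_lt h1 h3)
    nlinarith
  have hcount := card_lattice_small_average_le μ hκ hvar hL hs hm T hW0 (by linarith) A
    (fun a ha b hb => by
      have := norm_latticePt_sub_le hs (hAΓ ha) (hAΓ hb)
      calc ‖latticePt s a - latticePt s b‖ * (2 * κ) ≤ (4 * s * M) * (2 * κ) :=
            mul_le_mul_of_nonneg_right this (by positivity)
        _ ≤ √L := by linarith)
    (fun a ha => by
      have := hAnotBad a ha
      rw [hBad, Finset.mem_filter, not_and, not_le] at this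
      rw [← hθ]
      exact (this (hAΓ ha)).le)
  rw [hA, Finset.card_image_of_injOn hinj] at hcount
  have e : 2 * (2 * κ ^ 2 * √m) / s = 4 * κ ^ 2 * √m / s := by ring
  rw [e] at hcount
  rw [le_div_iff₀ hp0]
  have : (B.card : ℝ) * (p / 8) ≤ B.card * W :=
    mul_le_mul_of_nonneg_left hmass (Nat.cast_nonneg _)
  linarith

/-! ### Growth of sets of combinations -/

/-- The points `j * a + l * a'` with `a`, `a'` in `S` and `j + l = k`. -/
def comboSet (S : Set ℂ) (k : ℕ) : Set ℂ :=
  {b | ∃ a ∈ S, ∃ a' ∈ S, ∃ j l : ℕ, j + l = k ∧ b = j * a + l * a'}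

lemma comboSet_mono {S S' : Set ℂ} (h : S ⊆ S') (k : ℕ) : comboSet S k ⊆ comboSet S' k := by
  rintro b ⟨a, ha, a', ha', j, l, hjl, rfl⟩
  exact ⟨a, h ha, a', h ha', j, l, hjl, rfl⟩

open Classical in
/-- Interpolating between consecutive values of a functional that separates `A`. -/
lemma exists_chain {ι : Type*} (f : ℂ → ℝ)
    (hf : ∀ (j l : ℕ) (x y : ℂ), f (j * x + l * y) = j * f x + l * f y) (k : ℕ) (g : ι → ℂ)
    (A : Finset ι) (hA : A.Nonempty)
    (hsep : ∀ a ∈ A, ∀ b ∈ A, a ≠ b → 1 / 2 ≤ |f (g a) - f (g b)|) :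
    ∃ B : Finset ℂ, (B : Set ℂ) ⊆ comboSet (g '' A) k ∧
      (∀ b ∈ B, ∀ b' ∈ B, b ≠ b' → 1 / 2 ≤ |f b - f b'|) ∧ k * A.card + 1 ≤ B.card + k := by
  suffices H : A.Nonempty → (∀ a ∈ A, ∀ b ∈ A, a ≠ b → 1 / 2 ≤ |f (g a) - f (g b)|) →
      ∃ B : Finset ℂ, (B : Set ℂ) ⊆ comboSet (g '' A) k ∧
      (∀ b ∈ B, ∀ b' ∈ B, b ≠ b' → 1 / 2 ≤ |f b - f b'|) ∧ k * A.card + 1 ≤ B.card + k ∧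
      ∃ a ∈ A, (∀ x ∈ A, f (g x) ≤ f (g a)) ∧ ∀ b ∈ B, f b ≤ k * f (g a) by
    obtain ⟨B, h1, h2, h3, -⟩ := H hA hsep
    exact ⟨B, h1, h2, h3⟩
  clear hA hsep
  induction A using Finset.induction_on_max_value (fun a => f (g a)) with
  | empty => exact fun h => absurd h (by simp)
  | insert a A haA hmax ih =>
    intro _ hsep
    rcases A.eq_empty_or_nonempty with rfl | hne
    · refine ⟨{(k : ℂ) * g a}, ?_, by simp, by simp, a, by simp, by simp, ?_⟩
      · intro b hb
        rw [Finset.coe_singleton, Set.mem_singleton_iff] at hb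
        exact ⟨g a, by simp, g a, by simp, k, 0, by simp, by simp [hb]⟩
      · intro b hb
        rw [Finset.mem_singleton.1 hb]
        have := hf k 0 (g a) (g a)
        simp only [Nat.cast_zero, zero_mul, add_zero] at this
        exact this.le
    obtain ⟨B, hB1, hB2, hB3, a0, ha0, ha0max, hB4⟩ := ih hne fun x hx y hy =>
      hsep x (Finset.mem_insert_of_mem hx) y (Finset.mem_insert_of_mem hy)
    have hgap : 1 / 2 ≤ f (g a) - f (g a0) := by
      have h1 := hsep a (Finset.mem_insert_self _ _) a0 (Finset.mem_insert_of_mem ha0)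
        (fun h => haA (h ▸ ha0))
      rwa [abs_of_nonneg (by linarith [hmax a0 ha0])] at h1
    set c : ℕ → ℂ := fun j => ((j : ℕ) : ℂ) * g a + ((k - j : ℕ) : ℂ) * g a0 with hc
    have hfc : ∀ j ∈ Finset.Icc 1 k, f (c j) = k * f (g a0) + j * (f (g a) - f (g a0)) := by
      intro j hj
      simp only [hc]
      rw [hf, Nat.cast_sub (Finset.mem_Icc.1 hj).2]
      ring
    have hcsep : ∀ i ∈ Finset.Icc 1 k, ∀ j ∈ Finset.Icc 1 k, i < j →
        1 / 2 ≤ f (c j) - f (c i) := by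
      intro i hi j hj hij
      rw [hfc i hi, hfc j hj]
      have : (i : ℝ) + 1 ≤ j := by exact_mod_cast hij
      nlinarith
    have hBc : ∀ b ∈ B, ∀ j ∈ Finset.Icc 1 k, 1 / 2 ≤ f (c j) - f b := by
      intro b hb j hj
      have h1 := hB4 b hb
      have : (1 : ℝ) ≤ j := by exact_mod_cast (Finset.mem_Icc.1 hj).1
      rw [hfc j hj]
      nlinarith
    have hinj : Set.InjOn c (Finset.Icc 1 k : Finset ℕ) := by
      intro i hi j hj h
      rcases lt_trichotomy i j with hlt | heq | hlt
      · have := hcsep i hi j hj hlt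
        rw [h] at this
        norm_num at this
      · exact heq
      · have := hcsep j hj i hi hlt
        rw [h] at this
        norm_num at this
    have hdisj : Disjoint B ((Finset.Icc 1 k).image c) := by
      rw [Finset.disjoint_left]
      intro b hb hb'
      obtain ⟨j, hj, rfl⟩ := Finset.mem_image.1 hb'
      have := hBc _ hb j hj
      norm_num at this
    refine ⟨B ∪ (Finset.Icc 1 k).image c, ?_, ?_, ?_, a, Finset.mem_insert_self _ _, ?_, ?_⟩
    · intro b hb
      rcases Finset.mem_union.1 hb with hb | hb
      · exact comboSet_mono (Set.image_mono (Finset.coe_subset.2 (Finset.subset_insert _ _))) k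
          (hB1 hb)
      · obtain ⟨j, hj, rfl⟩ := Finset.mem_image.1 hb
        exact ⟨g a, ⟨a, by simp, rfl⟩, g a0, ⟨a0, by simp [ha0], rfl⟩, j, k - j,
          Nat.add_sub_cancel' (Finset.mem_Icc.1 hj).2, rfl⟩
    · intro b hb b' hb' hne'
      rcases Finset.mem_union.1 hb with hb | hb <;> rcases Finset.mem_union.1 hb' with hb' | hb'
      · exact hB2 b hb b' hb' hne'
      · obtain ⟨j, hj, rfl⟩ := Finset.mem_image.1 hb'
        rw [abs_sub_comm]
        exact (hBc b hb j hj).trans (le_abs_self _)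
      · obtain ⟨j, hj, rfl⟩ := Finset.mem_image.1 hb
        exact (hBc b' hb' j hj).trans (le_abs_self _)
      · obtain ⟨i, hi, rfl⟩ := Finset.mem_image.1 hb
        obtain ⟨j, hj, rfl⟩ := Finset.mem_image.1 hb'
        rcases lt_trichotomy i j with hlt | heq | hlt
        · rw [abs_sub_comm]
          exact (hcsep i hi j hj hlt).trans (le_abs_self _)
        · exact absurd (congrArg c heq) hne'
        · exact (hcsep j hj i hi hlt).trans (le_abs_self _)
    · rw [Finset.card_union_of_disjoint hdisj, Finset.card_image_of_injOn hinj, Nat.card_Icc,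
        Finset.card_insert_of_notMem haA]
      have : k * (A.card + 1) = k * A.card + k := by ring
      omega
    · intro x hx
      rcases Finset.mem_insert.1 hx with rfl | hx
      · exact le_rfl
      · exact hmax x hx
    · intro b hb
      rcases Finset.mem_union.1 hb with hb | hb
      · refine (hB4 b hb).trans ?_
        have : (0 : ℝ) ≤ k := Nat.cast_nonneg _
        nlinarith
      · obtain ⟨j, hj, rfl⟩ := Finset.mem_image.1 hb
        rw [hfc j hj]
        have : (j : ℝ) ≤ k := by exact_mod_cast (Finset.mem_Icc.1 hj).2
        nlinarith

lemma half_le_abs_sub_of_floor {x y : ℝ} (h : 2 ≤ |⌊2 * x⌋ - ⌊2 * y⌋|) : 1 / 2 ≤ |x - y| := by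
  have h1 := Int.floor_le (2 * x)
  have h2 := Int.lt_floor_add_one (2 * x)
  have h3 := Int.floor_le (2 * y)
  have h4 := Int.lt_floor_add_one (2 * y)
  rcases le_abs.1 h with h | h
  · have : (2 : ℝ) ≤ ⌊2 * x⌋ - ⌊2 * y⌋ := by exact_mod_cast h
    exact le_trans (by linarith) (le_abs_self _)
  · have : (2 : ℝ) ≤ -(⌊2 * x⌋ - ⌊2 * y⌋) := by exact_mod_cast h
    exact le_trans (by linarith) (neg_le_abs _)

lemma combo_re (j l : ℕ) (x y : ℂ) : ((j : ℂ) * x + l * y).re = j * x.re + l * y.re := by simp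

lemma combo_im (j l : ℕ) (x y : ℂ) : ((j : ℂ) * x + l * y).im = j * x.im + l * y.im := by simp

lemma two_le_abs_sub_of_emod {x y : ℤ} (h : x % 2 = y % 2) (hne : x ≠ y) : 2 ≤ |x - y| := by
  rw [le_abs]
  omega

open Classical in
/-- If separated sets of combinations are small, then few half-cells of one parity class are
occupied. -/
lemma card_cells_le (S : Set ℂ) {k : ℕ} (hk : 1 ≤ k) {N : ℝ}
    (hN : ∀ B : Finset ℂ, (B : Set ℂ) ⊆ comboSet S k →
      (∀ b ∈ B, ∀ b' ∈ B, b ≠ b' → 1 / 2 ≤ ‖b - b'‖) → (B.card : ℝ) ≤ N)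
    (r : ℤ × ℤ → ℂ) (C : Finset (ℤ × ℤ)) (hC : C.Nonempty) (hrS : ∀ c ∈ C, r c ∈ S)
    (hre : ∀ c ∈ C, ⌊2 * (r c).re⌋ = c.1) (him : ∀ c ∈ C, ⌊2 * (r c).im⌋ = c.2)
    (hp1 : ∀ c ∈ C, ∀ c' ∈ C, c.1 % 2 = c'.1 % 2) (hp2 : ∀ c ∈ C, ∀ c' ∈ C, c.2 % 2 = c'.2 % 2) :
    (k : ℝ) * C.card ≤ 2 * N + k := by
  have hsepre : ∀ c ∈ C, ∀ c' ∈ C, c.1 ≠ c'.1 → 1 / 2 ≤ |(r c).re - (r c').re| := by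
    intro c hc c' hc' hne
    refine half_le_abs_sub_of_floor ?_
    rw [hre c hc, hre c' hc']
    exact two_le_abs_sub_of_emod (hp1 c hc c' hc') hne
  have hsepim : ∀ c ∈ C, ∀ c' ∈ C, c.2 ≠ c'.2 → 1 / 2 ≤ |(r c).im - (r c').im| := by
    intro c hc c' hc' hne
    refine half_le_abs_sub_of_floor ?_
    rw [him c hc, him c' hc']
    exact two_le_abs_sub_of_emod (hp2 c hc c' hc') hne
  set cols := C.image Prod.fst with hcols
  have hchain : ∀ x ∈ cols, ∃ B : Finset ℂ,
      (B : Set ℂ) ⊆ comboSet (r '' (C.filter fun c => c.1 = x)) k ∧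
      (∀ b ∈ B, ∀ b' ∈ B, b ≠ b' → 1 / 2 ≤ |b.im - b'.im|) ∧
      k * (C.filter fun c => c.1 = x).card + 1 ≤ B.card + k := by
    intro x hx
    obtain ⟨c, hc, hcx⟩ := Finset.mem_image.1 hx
    refine exists_chain Complex.im combo_im k r _ ⟨c, Finset.mem_filter.2 ⟨hc, hcx⟩⟩ ?_
    intro a ha b hb hab
    rw [Finset.mem_filter] at ha hb
    exact hsepim a ha.1 b hb.1 fun h => hab (Prod.ext (ha.2.trans hb.2.symm) h)
  choose! Bx hBx1 hBx2 hBx3 using hchain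
  have hcolre : ∀ x ∈ cols, ∀ b ∈ Bx x, (k : ℝ) * x ≤ 2 * b.re ∧ 2 * b.re ≤ k * (x + 1) := by
    intro x hx b hb
    obtain ⟨_, ⟨c, hc, rfl⟩, _, ⟨c', hc', rfl⟩, j, l, hjl, rfl⟩ := hBx1 x hx hb
    rw [Finset.mem_coe, Finset.mem_filter] at hc hc'
    have h1 := Int.floor_le (2 * (r c).re)
    have h2 := Int.lt_floor_add_one (2 * (r c).re)
    have h3 := Int.floor_le (2 * (r c').re)
    have h4 := Int.lt_floor_add_one (2 * (r c').re)
    rw [hre c hc.1, hc.2] at h1 h2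
    rw [hre c' hc'.1, hc'.2] at h3 h4
    rw [combo_re, ← hjl]
    push_cast
    have hj : (0 : ℝ) ≤ j := Nat.cast_nonneg _
    have hl : (0 : ℝ) ≤ l := Nat.cast_nonneg _
    constructor <;> nlinarith
  have hk1 : (1 : ℝ) ≤ k := by exact_mod_cast hk
  have hcross : ∀ x ∈ cols, ∀ y ∈ cols, x < y → ∀ b ∈ Bx x, ∀ b' ∈ Bx y,
      1 / 2 ≤ b'.re - b.re := by
    intro x hx y hy hxy b hb b' hb'
    obtain ⟨c, hc, rfl⟩ := Finset.mem_image.1 hx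
    obtain ⟨c', hc', rfl⟩ := Finset.mem_image.1 hy
    have h2 : c.1 + 2 ≤ c'.1 := by
      have := hp1 c hc c' hc'
      omega
    have h2' : (c.1 : ℝ) + 2 ≤ c'.1 := by exact_mod_cast h2
    have h3 := (hcolre _ hx b hb).2
    have h4 := (hcolre _ hy b' hb').1
    nlinarith
  have hdisj : (cols : Set ℤ).PairwiseDisjoint Bx := by
    intro x hx y hy hxy
    rw [Function.onFun, Finset.disjoint_left]
    intro b hb hb'
    rcases lt_or_gt_of_ne hxy with h | h
    · have := hcross x hx y hy h b hb b hb'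
      norm_num at this
    · have := hcross y hy x hx h b hb' b hb
      norm_num at this
  have hB1 := hN (cols.biUnion Bx) (by
    intro b hb
    obtain ⟨x, hx, hb⟩ := Finset.mem_biUnion.1 hb
    refine comboSet_mono ?_ k (hBx1 x hx hb)
    rintro _ ⟨c, hc, rfl⟩
    exact hrS c (Finset.mem_filter.1 hc).1) (by
    intro b hb b' hb' hne
    obtain ⟨x, hx, hb⟩ := Finset.mem_biUnion.1 hb
    obtain ⟨y, hy, hb'⟩ := Finset.mem_biUnion.1 hb'
    rcases lt_trichotomy x y with h | h | h
    · rw [norm_sub_rev]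
      exact (hcross x hx y hy h b hb b' hb').trans
        ((le_abs_self _).trans (Complex.abs_re_le_norm (b' - b)))
    · subst h
      exact (hBx2 x hx b hb b' hb' hne).trans (Complex.abs_im_le_norm (b - b'))
    · exact (hcross y hy x hx h b' hb' b hb).trans
        ((le_abs_self _).trans (Complex.abs_re_le_norm (b - b'))))
  rw [Finset.card_biUnion hdisj] at hB1
  have hsel : ∀ x ∈ cols, ∃ c ∈ C, c.1 = x := fun x hx => Finset.mem_image.1 hx
  choose! sel hsel1 hsel2 using hsel
  obtain ⟨B2, hB21, hB22, hB23⟩ := exists_chain Complex.re combo_re k (fun x => r (sel x)) cols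
    (hC.image _) (fun x hx y hy hxy => hsepre _ (hsel1 x hx) _ (hsel1 y hy)
      (by rwa [hsel2 x hx, hsel2 y hy]))
  have hB2 := hN B2 (hB21.trans (comboSet_mono (by
    rintro _ ⟨x, hx, rfl⟩
    exact hrS _ (hsel1 x hx)) k)) fun b hb b' hb' hne =>
      (hB22 b hb b' hb' hne).trans (Complex.abs_re_le_norm (b - b'))
  have hcard : C.card = ∑ x ∈ cols, (C.filter fun c => c.1 = x).card :=
    Finset.card_eq_sum_card_image Prod.fst C
  have hsum : k * C.card ≤ ∑ x ∈ cols, (Bx x).card + k * cols.card := by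
    rw [hcard, Finset.mul_sum, mul_comm k cols.card, ← smul_eq_mul, ← Finset.sum_const,
      ← Finset.sum_add_distrib]
    exact Finset.sum_le_sum fun x hx => by have := hBx3 x hx; omega
  have hfin : k * C.card ≤ ∑ x ∈ cols, (Bx x).card + B2.card + k := by omega
  have hfin' : (k : ℝ) * C.card ≤ (∑ x ∈ cols, (Bx x).card : ℕ) + B2.card + k := by
    exact_mod_cast hfin
  linarith

/-- The lower left corner of a half-cell. -/
noncomputable def cellCorner (c : ℤ × ℤ) : ℂ := ⟨c.1 / 2, c.2 / 2⟩

lemma norm_sub_cellCorner_le (w : ℂ) : ‖w - cellCorner (⌊2 * w.re⌋, ⌊2 * w.im⌋)‖ ≤ 1 := by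
  refine (Complex.norm_le_abs_re_add_abs_im _).trans ?_
  have key : ∀ x : ℝ, |x - (⌊2 * x⌋ : ℝ) / 2| ≤ 1 / 2 := by
    intro x
    have h1 := Int.floor_le (2 * x)
    have h2 := Int.lt_floor_add_one (2 * x)
    rw [abs_le]
    constructor <;> linarith
  have h1 := key w.re
  have h2 := key w.im
  simp only [cellCorner, Complex.sub_re, Complex.sub_im]
  linarith

lemma floor_two_mul_mem_Icc {x : ℝ} {M : ℕ} (hx : |x| ≤ M) :
    ⌊2 * x⌋ ∈ Finset.Icc (-(2 * M : ℤ)) (2 * M) := by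
  have := abs_le.1 hx
  rw [Finset.mem_Icc, Int.le_floor]
  constructor
  · push_cast
    linarith
  · have h : (⌊2 * x⌋ : ℝ) ≤ (2 * M : ℤ) := (Int.floor_le _).trans (by push_cast; linarith)
    exact_mod_cast h

lemma exists_cover_disk (M : ℕ) : ∃ Q : Finset ℂ, Q.card ≤ (4 * M + 1) ^ 2 ∧
    ∀ w : ℂ, ‖w‖ ≤ M → ∃ z ∈ Q, ‖w - z‖ ≤ 1 := by
  classical
  refine ⟨((Finset.Icc (-(2 * M : ℤ)) (2 * M)) ×ˢ (Finset.Icc (-(2 * M : ℤ)) (2 * M))).image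
    cellCorner, ?_, fun w hw => ⟨_, Finset.mem_image_of_mem _ (Finset.mem_product.2
      ⟨floor_two_mul_mem_Icc ((Complex.abs_re_le_norm w).trans hw),
        floor_two_mul_mem_Icc ((Complex.abs_im_le_norm w).trans hw)⟩), norm_sub_cellCorner_le w⟩⟩
  refine Finset.card_image_le.trans ?_
  have e : (2 * (M : ℤ) + 1 - -(2 * (M : ℤ))).toNat = 4 * M + 1 := by omega
  rw [Finset.card_product, Int.card_Icc, e, sq]

lemma exists_cover_of_growth (S : Set ℂ) {k : ℕ} (hk : 1 ≤ k) {N ρ : ℝ} (hS : ∀ w ∈ S, ‖w‖ ≤ ρ)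
    (hN : ∀ B : Finset ℂ, (B : Set ℂ) ⊆ comboSet S k →
      (∀ b ∈ B, ∀ b' ∈ B, b ≠ b' → 1 / 2 ≤ ‖b - b'‖) → (B.card : ℝ) ≤ N) :
    ∃ P : Finset ℂ, (P.card : ℝ) ≤ 4 + 8 * N / k ∧ ∀ w ∈ S, ∃ z ∈ P, ‖w - z‖ ≤ 1 := by
  classical
  obtain ⟨M, hM⟩ := exists_nat_ge ρ
  set I := Finset.Icc (-(2 * M : ℤ)) (2 * M)
  set C := (I ×ˢ I).filter fun c => ∃ w ∈ S, (⌊2 * w.re⌋, ⌊2 * w.im⌋) = c with hC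
  have hrep : ∀ c ∈ C, ∃ w ∈ S, (⌊2 * w.re⌋, ⌊2 * w.im⌋) = c := fun c hc =>
    (Finset.mem_filter.1 hc).2
  choose! r hrS hrc using hrep
  have hk0 : (0 : ℝ) < k := by exact_mod_cast hk
  have hN0 : 0 ≤ N := by simpa using hN ∅ (by simp) (by simp)
  have hclass : ∀ e : ℤ × ℤ,
      ((C.filter fun c => (c.1 % 2, c.2 % 2) = e).card : ℝ) ≤ 1 + 2 * N / k := by
    intro e
    set D := C.filter fun c => (c.1 % 2, c.2 % 2) = e with hD
    have hDC : ∀ c ∈ D, c ∈ C := fun c hc => (Finset.mem_filter.1 hc).1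
    have hDe : ∀ c ∈ D, (c.1 % 2, c.2 % 2) = e := fun c hc => (Finset.mem_filter.1 hc).2
    rcases D.eq_empty_or_nonempty with h | h
    · rw [h, Finset.card_empty]
      push_cast
      positivity
    · have := card_cells_le S hk hN r D h (fun c hc => hrS c (hDC c hc))
        (fun c hc => congrArg Prod.fst (hrc c (hDC c hc)))
        (fun c hc => congrArg Prod.snd (hrc c (hDC c hc)))
        (fun c hc c' hc' => congrArg Prod.fst ((hDe c hc).trans (hDe c' hc').symm))
        (fun c hc c' hc' => congrArg Prod.snd ((hDe c hc).trans (hDe c' hc').symm))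
      rw [← mul_le_mul_iff_right₀ hk0, mul_add, mul_div_cancel₀ _ hk0.ne']
      linarith
  have hcard : (C.card : ℝ) ≤ 4 + 8 * N / k := by
    have h1 : C.card = ∑ e ∈ (({0, 1} : Finset ℤ) ×ˢ ({0, 1} : Finset ℤ)),
        (C.filter fun c => (c.1 % 2, c.2 % 2) = e).card := by
      refine Finset.card_eq_sum_card_fiberwise fun c _ => ?_
      simp only [Finset.coe_product, Set.mem_prod, Finset.coe_insert, Finset.coe_singleton,
        Set.mem_insert_iff, Set.mem_singleton_iff]
      exact ⟨Int.emod_two_eq_zero_or_one _, Int.emod_two_eq_zero_or_one _⟩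
    rw [h1]
    push_cast
    refine (Finset.sum_le_card_nsmul _ _ _ fun e _ => hclass e).trans (le_of_eq ?_)
    rw [Finset.card_product, nsmul_eq_mul]
    norm_num
    ring
  refine ⟨C.image cellCorner, (Nat.cast_le.2 Finset.card_image_le).trans hcard, fun w hw => ?_⟩
  refine ⟨_, Finset.mem_image_of_mem _ (Finset.mem_filter.2 ⟨Finset.mem_product.2 ⟨?_, ?_⟩,
    w, hw, rfl⟩), norm_sub_cellCorner_le w⟩
  · exact floor_two_mul_mem_Icc ((Complex.abs_re_le_norm w).trans ((hS w hw).trans hM))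
  · exact floor_two_mul_mem_Icc ((Complex.abs_im_le_norm w).trans ((hS w hw).trans hM))

/-! ### Nets -/

open Classical in
lemma exists_net {n n' : ℕ} (hn' : n' ≤ n) (PP : Finset (Finset ℂ)) {N : ℝ}
    (hN1 : 1 ≤ N) (hN : ∀ P ∈ PP, (P.card : ℝ) ≤ N) (Q : Finset ℂ) {β : ℝ} (hβ : 0 < β) :
    ∃ S' : Finset (Fin n → ℂ),
      (S'.card : ℝ) ≤ PP.card * ((n : ℝ) * Q.card) ^ n' * N ^ n ∧
      ∀ v : Fin n → ℂ, (∀ i, ∃ z ∈ Q, ‖v i / β - z‖ ≤ 1) →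
        (∃ P ∈ PP, ∃ J : Finset (Fin n), J.card ≤ n' ∧ ∀ i ∉ J, ∃ z ∈ P, ‖v i / β - z‖ ≤ 1) →
        ∃ v' ∈ S', ∀ i, ‖v i - v' i‖ ≤ β := by
  set box : Finset ℂ → Finset (Fin n) → Finset (Fin n → ℂ) := fun P J =>
    (Fintype.piFinset fun i => if i ∈ J then Q else P).image fun z i => (β : ℂ) * z i with hbox
  have hβ' : (β : ℂ) ≠ 0 := by exact_mod_cast hβ.ne'
  refine ⟨PP.biUnion fun P => (Finset.powersetCard n' Finset.univ).biUnion (box P), ?_, ?_⟩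
  · have hboxcard : ∀ P ∈ PP, ∀ J ∈ Finset.powersetCard n' (Finset.univ : Finset (Fin n)),
        ((box P J).card : ℝ) ≤ (Q.card : ℝ) ^ n' * N ^ n := by
      intro P hP J hJ
      have hJ' := (Finset.mem_powersetCard.1 hJ).2
      refine (Nat.cast_le.2 Finset.card_image_le).trans ?_
      rw [Fintype.card_piFinset]
      have e : ∏ i, (if i ∈ J then Q else P).card = Q.card ^ n' * P.card ^ (n - n') := by
        simp only [apply_ite Finset.card]
        rw [Finset.prod_ite, Finset.prod_const, Finset.prod_const, Finset.filter_mem_eq_inter,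
          Finset.univ_inter, hJ']
        congr 2
        rw [Finset.filter_not, Finset.filter_mem_eq_inter, Finset.univ_inter,
          ← Finset.compl_eq_univ_sdiff, Finset.card_compl, hJ', Fintype.card_fin]
      rw [e]
      push_cast
      refine mul_le_mul_of_nonneg_left ?_ (by positivity)
      exact (pow_le_pow_left₀ (Nat.cast_nonneg _) (hN P hP) _).trans
        (pow_le_pow_right₀ hN1 (Nat.sub_le _ _))
    have hin : ∀ P ∈ PP, (((Finset.powersetCard n' Finset.univ).biUnion (box P)).card : ℝ)
        ≤ (n : ℝ) ^ n' * ((Q.card : ℝ) ^ n' * N ^ n) := by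
      intro P hP
      calc (((Finset.powersetCard n' Finset.univ).biUnion (box P)).card : ℝ)
          ≤ ∑ J ∈ Finset.powersetCard n' (Finset.univ : Finset (Fin n)), ((box P J).card : ℝ) := by
            exact_mod_cast Finset.card_biUnion_le
        _ ≤ (Finset.powersetCard n' (Finset.univ : Finset (Fin n))).card
              • ((Q.card : ℝ) ^ n' * N ^ n) := Finset.sum_le_card_nsmul _ _ _ (hboxcard P hP)
        _ ≤ _ := by
            rw [nsmul_eq_mul, Finset.card_powersetCard, Finset.card_univ, Fintype.card_fin]
            refine mul_le_mul_of_nonneg_right ?_ (by positivity)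
            exact_mod_cast Nat.choose_le_pow n n'
    calc _ ≤ ∑ P ∈ PP, (((Finset.powersetCard n' Finset.univ).biUnion (box P)).card : ℝ) := by
          exact_mod_cast Finset.card_biUnion_le
      _ ≤ PP.card • ((n : ℝ) ^ n' * ((Q.card : ℝ) ^ n' * N ^ n)) :=
          Finset.sum_le_card_nsmul _ _ _ hin
      _ = _ := by
          rw [nsmul_eq_mul, mul_pow]
          ring
  · rintro v hQ ⟨P, hP, J, hJ, hPJ⟩
    obtain ⟨J', hJJ', -, hJ'⟩ := Finset.exists_subsuperset_card_eq (Finset.subset_univ J) hJ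
      (by rwa [Finset.card_univ, Fintype.card_fin])
    have hz : ∀ i, ∃ z ∈ (if i ∈ J' then Q else P), ‖v i / β - z‖ ≤ 1 := by
      intro i
      split_ifs with h
      · exact hQ i
      · exact hPJ i fun hi => h (hJJ' hi)
    choose z hz1 hz2 using hz
    refine ⟨fun i => (β : ℂ) * z i, ?_, fun i => ?_⟩
    · simp only [Finset.mem_biUnion]
      exact ⟨P, hP, J', Finset.mem_powersetCard.2 ⟨Finset.subset_univ _, hJ'⟩,
        Finset.mem_image.2 ⟨z, Fintype.mem_piFinset.2 hz1, rfl⟩⟩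
    · have e : v i - β * z i = β * (v i / β - z i) := by
        field_simp
      rw [e, norm_mul, Complex.norm_of_nonneg hβ.le]
      exact mul_le_of_le_one_right hβ.le (hz2 i)

/-- Points of norm at most `ρ` with empirical gap at most `e`. -/
def smallGapSet (μ : Measure ℂ) {q : ℕ} (ξ : Fin q → ℂ) (ρ e : ℝ) : Set ℂ :=
  {w | ‖w‖ ≤ ρ ∧ empGap μ ξ w ≤ e}

lemma norm_le_of_mem_comboSet (μ : Measure ℂ) {q : ℕ} (ξ : Fin q → ℂ) {ρ e : ℝ} {k : ℕ} {b : ℂ}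
    (hb : b ∈ comboSet (smallGapSet μ ξ ρ e) k) : ‖b‖ ≤ k * ρ := by
  obtain ⟨a, ha, a', ha', j, l, rfl, rfl⟩ := hb
  refine (norm_add_le _ _).trans ?_
  rw [norm_mul, norm_mul, Complex.norm_natCast, Complex.norm_natCast]
  push_cast
  have hj : (0 : ℝ) ≤ j := Nat.cast_nonneg _
  have hl : (0 : ℝ) ≤ l := Nat.cast_nonneg _
  nlinarith [ha.1, ha'.1]

lemma empGap_le_of_mem_comboSet (μ : Measure ℂ) [IsProbabilityMeasure μ] {q : ℕ} (ξ : Fin q → ℂ)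
    {ρ e : ℝ} {k : ℕ} {b : ℂ} (hb : b ∈ comboSet (smallGapSet μ ξ ρ e) k) :
    empGap μ ξ b ≤ (k : ℝ) ^ 2 * e := by
  obtain ⟨a, ha, a', ha', j, l, rfl, rfl⟩ := hb
  refine (empGap_combo_le μ ξ j l a a').trans ?_
  push_cast
  have hj : (0 : ℝ) ≤ j := Nat.cast_nonneg _
  have hl : (0 : ℝ) ≤ l := Nat.cast_nonneg _
  have : (j : ℝ) * empGap μ ξ a + l * empGap μ ξ a' ≤ (j + l) * e := by nlinarith [ha.2, ha'.2]
  calc ((j : ℝ) + l) * (j * empGap μ ξ a + l * empGap μ ξ a') ≤ (j + l) * ((j + l) * e) :=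
        mul_le_mul_of_nonneg_left this (by positivity)
    _ = _ := by ring

/-- The frequencies `ξ` have at most `N` separated `k`-fold combinations of small-gap points. -/
def SparseCombos (μ : Measure ℂ) {q : ℕ} (ξ : Fin q → ℂ) (ρ e : ℝ) (k : ℕ) (N : ℝ) : Prop :=
  ∀ B : Finset ℂ, (B : Set ℂ) ⊆ comboSet (smallGapSet μ ξ ρ e) k →
    (∀ b ∈ B, ∀ b' ∈ B, b ≠ b' → 1 / 2 ≤ ‖b - b'‖) → (B.card : ℝ) ≤ N

lemma SparseCombos.norm_le_one {μ : Measure ℂ} [IsProbabilityMeasure μ] {q : ℕ} {ξ : Fin q → ℂ}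
    {ρ e : ℝ} {k : ℕ} {N : ℝ} (h : SparseCombos μ ξ ρ e k N) (hρ : 0 ≤ ρ) (he : 0 ≤ e)
    (hNk : N < k + 1) {w : ℂ} (hw : w ∈ smallGapSet μ ξ ρ e) : ‖w‖ ≤ 1 := by
  classical
  by_contra! hw1
  have h0 : (0 : ℂ) ∈ smallGapSet μ ξ ρ e := by
    refine ⟨by simpa using hρ, ?_⟩
    have : phaseGap μ 0 = 0 := by rw [phaseGap_eq_integral]; simp
    simpa [empGap, this] using he
  have hdist : ∀ i j : ℕ, i ≠ j → 1 ≤ ‖(i : ℂ) * w - j * w‖ := by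
    intro i j hij
    have h1 : (1 : ℝ) ≤ ‖((i : ℂ) - j)‖ := by
      have e : ((i : ℂ) - j) = (((i : ℤ) - j : ℤ) : ℂ) := by push_cast; rfl
      rw [e, Complex.norm_intCast]
      have := Int.one_le_abs (sub_ne_zero.2 (Nat.cast_injective.ne hij) : (i : ℤ) - j ≠ 0)
      exact_mod_cast this
    rw [← sub_mul, norm_mul]
    nlinarith
  have hinj : Function.Injective fun j : ℕ => (j : ℂ) * w := by
    intro i j hij
    by_contra hne
    have := hdist i j hne
    simp only at hij
    rw [hij, sub_self, norm_zero] at this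
    norm_num at this
  have := h ((Finset.range (k + 1)).image fun j : ℕ => (j : ℂ) * w) (by
    intro b hb
    obtain ⟨j, hj, rfl⟩ := Finset.mem_image.1 hb
    exact ⟨w, hw, 0, h0, j, k - j, Nat.add_sub_cancel' (Finset.mem_range_succ_iff.1 hj),
      by simp⟩) (by
    intro b hb b' hb' hne
    obtain ⟨i, hi, rfl⟩ := Finset.mem_image.1 hb
    obtain ⟨j, hj, rfl⟩ := Finset.mem_image.1 hb'
    have := hdist i j fun hij => hne (by rw [hij])
    linarith)
  rw [Finset.card_image_of_injective _ hinj, Finset.card_range] at this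
  push_cast at this
  linarith

lemma exists_sparse_frequencies {n n' : ℕ} (μ : Measure ℂ) [IsProbabilityMeasure μ] {κ : ℝ}
    (hκ : 1 ≤ κ) (hint : Integrable (fun a : ℂ => ‖a‖ ^ 2) μ) (hmom : ∫ a, ‖a‖ ^ 2 ∂μ ≤ κ)
    (hvar : ∀ z w : ℂ, z.re ^ 2 / κ ≤ ∫ a in {a | ‖a‖ ≤ κ}, ((z * a - w).re) ^ 2 ∂μ)
    (v : Fin n → ℂ) {β p m : ℝ} (hβ : 0 < β) (hm : 0 ≤ m) (hp : Real.exp (-m / 2) ≤ p / 64)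
    (hv : p ≤ smallBall μ v β) {L : ℕ} (hL : 0 < L) (hLe : Even L)
    {s θ e : ℝ} (hs : 0 < s) (hs4 : s < 1 / 4) (hθ : θ = 1 / (16 * κ ^ 6))
    (hsm : 256 * κ * m * s ^ 2 ≤ θ) {M q k : ℕ} (hM : k * (1 / β) / s + 1 ≤ M)
    (hML : 8 * κ * s * M ≤ √L) (hq : (2 * (M : ℝ) + 1) ^ 2 < Real.exp (q * θ / 4))
    (he : 0 < e) (hke : (k : ℝ) ^ 2 * e ≤ θ / 32) (hn' : m < e * (n' + 1)) :
    ∃ t : Fin q → Fin (L + 1) × Fin (L + 1),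
      (Finset.univ.filter fun i => e < empGap μ (fun l => testPoint L (t l)) (v i / β)).card ≤ n' ∧
      SparseCombos μ (fun l => testPoint L (t l)) (1 / β) e k
        (64 * (4 * κ ^ 2 * √m / s + 1) ^ 2 / p) := by
  obtain ⟨t, ht1, ht2⟩ := exists_frequencies μ hκ hint hmom hvar v hβ hm hp hv hL hLe hs hs4 hθ
    hsm hM hML hq
  refine ⟨t, ?_, fun B hB hBs => ht2 B (fun b hb => norm_le_of_mem_comboSet μ _ (hB hb))
    (fun b hb => (empGap_le_of_mem_comboSet μ _ (hB hb)).trans hke) hBs⟩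
  set J := Finset.univ.filter fun i => e < empGap μ (fun l => testPoint L (t l)) (v i / β)
  have h1 : (J.card : ℝ) * e ≤ m := by
    rw [← nsmul_eq_mul]
    refine le_trans (Finset.card_nsmul_le_sum J
      (fun i => empGap μ (fun l => testPoint L (t l)) (v i / β)) e
      fun i hi => (Finset.mem_filter.1 hi).2.le) (le_trans ?_ ht1)
    exact Finset.sum_le_univ_sum_of_nonneg fun i => empGap_nonneg μ _ _
  have h2 : (J.card : ℝ) < n' + 1 := by
    refine lt_of_mul_lt_mul_right ?_ he.le
    linarith
  exact_mod_cast Nat.lt_succ_iff.1 (by exact_mod_cast h2)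

lemma norm_div_le_of_unit {n : ℕ} {v : Fin n → ℂ} (hv : ∑ i, ‖v i‖ ^ 2 = 1) {β : ℝ} (hβ : 0 < β)
    (i : Fin n) : ‖v i / β‖ ≤ 1 / β := by
  rw [norm_div, Complex.norm_of_nonneg hβ.le]
  gcongr
  have : ‖v i‖ ^ 2 ≤ 1 := hv ▸ Finset.single_le_sum (f := fun i => ‖v i‖ ^ 2)
    (fun _ _ => by positivity) (Finset.mem_univ i)
  exact (sq_le_one_iff₀ (norm_nonneg _)).1 this

open Classical in
/-- The net obtained from the structure of vectors with large small ball probability. -/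
lemma exists_net_of_params {n n' : ℕ} (hn'n : n' ≤ n)
    (μ : Measure ℂ) [IsProbabilityMeasure μ] {κ : ℝ}
    (hκ : 1 ≤ κ) (hint : Integrable (fun a : ℂ => ‖a‖ ^ 2) μ) (hmom : ∫ a, ‖a‖ ^ 2 ∂μ ≤ κ)
    (hvar : ∀ z w : ℂ, z.re ^ 2 / κ ≤ ∫ a in {a | ‖a‖ ≤ κ}, ((z * a - w).re) ^ 2 ∂μ)
    {β p m : ℝ} (hβ : 0 < β) (hm : 0 ≤ m) (hp : Real.exp (-m / 2) ≤ p / 64)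
    {L : ℕ} (hL : 0 < L) (hLe : Even L)
    {s θ e : ℝ} (hs : 0 < s) (hs4 : s < 1 / 4) (hθ : θ = 1 / (16 * κ ^ 6))
    (hsm : 256 * κ * m * s ^ 2 ≤ θ) {M q k : ℕ} (hM : k * (1 / β) / s + 1 ≤ M)
    (hML : 8 * κ * s * M ≤ √L) (hq : (2 * (M : ℝ) + 1) ^ 2 < Real.exp (q * θ / 4))
    (he : 0 < e) (hk : 1 ≤ k) (hke : (k : ℝ) ^ 2 * e ≤ θ / 32) (hn' : m < e * (n' + 1))
    {N : ℝ} (hN : 64 * (4 * κ ^ 2 * √m / s + 1) ^ 2 / p ≤ N) {X Y : ℝ}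
    (hX : ((n : ℝ) * (4 * ⌈1 / β⌉₊ + 1) ^ 2) ^ n' ≤ X)
    (hXY : (N < k + 1 ∧ X ≤ Y) ∨ ((L : ℝ) + 1) ^ (2 * q) * X * (4 + 8 * N / k) ^ n ≤ Y) :
    ∃ S' : Finset (Fin n → ℂ), (S'.card : ℝ) ≤ Y ∧
      ∀ v : Fin n → ℂ, (∑ i, ‖v i‖ ^ 2) = 1 → p ≤ smallBall μ v β →
        ∃ v' ∈ S', ∀ i, ‖v i - v' i‖ ≤ β := by
  have hβ1 : 0 ≤ 1 / β := by positivity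
  obtain ⟨Q, hQ, hQc⟩ := exists_cover_disk ⌈1 / β⌉₊
  have hQX : ((n : ℝ) * Q.card) ^ n' ≤ X := by
    refine le_trans ?_ hX
    gcongr
    exact_mod_cast hQ
  have hQv : ∀ v : Fin n → ℂ, (∑ i, ‖v i‖ ^ 2) = 1 → ∀ i, ∃ z ∈ Q, ‖v i / β - z‖ ≤ 1 :=
    fun v hv i => hQc _ ((norm_div_le_of_unit hv hβ i).trans (Nat.le_ceil _))
  have hstruct := fun (v : Fin n → ℂ) (hv : p ≤ smallBall μ v β) =>
    exists_sparse_frequencies (n' := n') μ hκ hint hmom hvar v hβ hm hp hv hL hLe hs hs4 hθ hsm hM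
      hML hq he hke hn'
  set N₀ := 64 * (4 * κ ^ 2 * √m / s + 1) ^ 2 / p with hN₀
  have hp0 : 0 < p := by linarith [Real.exp_pos (-m / 2)]
  have hN₀0 : 0 ≤ N₀ := by positivity
  have hk0 : (0 : ℝ) < k := by exact_mod_cast hk
  set ξ : (Fin q → Fin (L + 1) × Fin (L + 1)) → Fin q → ℂ := fun t l => testPoint L (t l) with hξ
  rcases hXY with ⟨hNk, hXY⟩ | hXY
  · obtain ⟨S', hS', hcov⟩ := exists_net hn'n {({0} : Finset ℂ)} le_rfl
      (by simp) Q hβ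
    refine ⟨S', hS'.trans ?_, fun v hv hvp => hcov v (hQv v hv) ?_⟩
    · simpa using hQX.trans hXY
    · obtain ⟨t, ht1, ht2⟩ := hstruct v hvp
      refine ⟨{0}, by simp, _, ht1, fun i hi => ⟨0, by simp, ?_⟩⟩
      rw [sub_zero]
      refine ht2.norm_le_one hβ1 he.le (by linarith) ⟨norm_div_le_of_unit hv hβ i, ?_⟩
      simpa using hi
  · have hcover : ∀ t, SparseCombos μ (ξ t) (1 / β) e k N₀ → ∃ P : Finset ℂ,
        (P.card : ℝ) ≤ 4 + 8 * N₀ / k ∧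
          ∀ w ∈ smallGapSet μ (ξ t) (1 / β) e, ∃ z ∈ P, ‖w - z‖ ≤ 1 :=
      fun t ht => exists_cover_of_growth _ hk (fun w hw => hw.1) ht
    choose P hP1 hP2 using hcover
    set PP : Finset (Finset ℂ) := Finset.univ.image fun t =>
      if h : SparseCombos μ (ξ t) (1 / β) e k N₀ then P t h else ∅ with hPP
    have hPPcard : (PP.card : ℝ) ≤ ((L : ℝ) + 1) ^ (2 * q) := by
      have : PP.card ≤ (L + 1) ^ (2 * q) := by
        refine Finset.card_image_le.trans (le_of_eq ?_)
        rw [Finset.card_univ, Fintype.card_fun, Fintype.card_prod, Fintype.card_fin,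
          Fintype.card_fin, ← sq, ← pow_mul]
      exact_mod_cast this
    have hPPN : ∀ R ∈ PP, (R.card : ℝ) ≤ 4 + 8 * N₀ / k := by
      intro R hR
      obtain ⟨t, -, rfl⟩ := Finset.mem_image.1 hR
      split_ifs with h
      · exact hP1 t h
      · rw [Finset.card_empty, Nat.cast_zero]
        positivity
    have hone : 1 ≤ 4 + 8 * N₀ / k := by
      have : 0 ≤ 8 * N₀ / k := by positivity
      linarith
    obtain ⟨S', hS', hcov⟩ := exists_net hn'n PP hone hPPN Q hβ
    refine ⟨S', hS'.trans (le_trans ?_ hXY), fun v hv hvp => hcov v (hQv v hv) ?_⟩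
    · have hX0 : 0 ≤ X := le_trans (by positivity) hQX
      gcongr
    · obtain ⟨t, ht1, ht2⟩ := hstruct v hvp
      refine ⟨P t ht2, Finset.mem_image.2 ⟨t, Finset.mem_univ _, by rw [dif_pos ht2]⟩, _, ht1,
        fun i hi => hP2 t ht2 _ ⟨norm_div_le_of_unit hv hβ i, ?_⟩⟩
      simpa using hi

/-! ### Choice of parameters -/

lemma exists_sampling_params {κ θ s R G : ℝ} (hκ : 1 ≤ κ) (hθ0 : 0 < θ) (hθ1 : θ ≤ 1)
    (hs0 : 0 < s) (hs1 : s ≤ 1) (hR : 0 ≤ R) (hG : 1 ≤ G) (hRG : R + 2 ≤ Real.exp (2 * G))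
    (hκG : 8 * κ + 1 ≤ Real.exp G) :
    ∃ M q L : ℕ, 0 < L ∧ Even L ∧ R + 1 ≤ M ∧ 8 * κ * s * M ≤ √L ∧
      (2 * (M : ℝ) + 1) ^ 2 < Real.exp (q * θ / 4) ∧
      ((L : ℝ) + 1) ^ (2 * q) ≤ Real.exp (544 / θ * G ^ 2) := by
  have hE1 : 1 ≤ Real.exp (2 * G) := Real.one_le_exp (by linarith)
  have h3 : 3 ≤ Real.exp (2 * G) := by linarith [Real.add_one_le_exp (2 * G)]
  set M := ⌈R + 1⌉₊ with hM
  have hM1 : R + 1 ≤ M := Nat.le_ceil _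
  have hM2 : (M : ℝ) ≤ Real.exp (2 * G) := by
    have := Nat.ceil_lt_add_one (show 0 ≤ R + 1 by linarith)
    linarith
  have hM0 : (1 : ℝ) ≤ M := by linarith
  set U := ⌈8 * κ * M⌉₊ with hU
  have hU1 : 8 * κ * M ≤ U := Nat.le_ceil _
  have hU2 : (U : ℝ) ≤ Real.exp (3 * G) := by
    have h1 := Nat.ceil_lt_add_one (show 0 ≤ 8 * κ * (M : ℝ) by positivity)
    have h2 : Real.exp (3 * G) = Real.exp G * Real.exp (2 * G) := by
      rw [← Real.exp_add]
      congr 1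
      ring
    have h4 : (8 * κ + 1) * Real.exp (2 * G) ≤ Real.exp G * Real.exp (2 * G) :=
      mul_le_mul_of_nonneg_right hκG (by positivity)
    have h5 : 8 * κ * M ≤ 8 * κ * Real.exp (2 * G) :=
      mul_le_mul_of_nonneg_left hM2 (by positivity)
    rw [h2]
    linarith
  have hUpos : (0 : ℝ) < U := by
    have : 0 < 8 * κ * (M : ℝ) := by positivity
    linarith
  set l := ⌈32 * G / θ⌉₊ with hl
  have hl1 : 32 * G / θ ≤ l := Nat.le_ceil _
  have hl2 : ((l + 1 : ℕ) : ℝ) ≤ 34 * G / θ := by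
    have h1 := Nat.ceil_lt_add_one (show 0 ≤ 32 * G / θ by positivity)
    have h2 : 1 ≤ G / θ := (one_le_div hθ0).2 (by linarith)
    have h4 : 34 * G / θ = 32 * G / θ + 2 * (G / θ) := by ring
    push_cast
    linarith
  refine ⟨M, l + 1, 2 * U ^ 2, ?_, even_two_mul _, hM1, ?_, ?_, ?_⟩
  · have : 0 < U := by exact_mod_cast hUpos
    positivity
  · refine Real.le_sqrt_of_sq_le ?_
    push_cast
    have h1 : 8 * κ * s * M ≤ U := by
      refine le_trans ?_ hU1
      have : 0 ≤ 8 * κ * (M : ℝ) := by positivity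
      nlinarith
    have := pow_le_pow_left₀ (show 0 ≤ 8 * κ * s * M by positivity) h1 2
    nlinarith
  · have h1 : 2 * (M : ℝ) + 1 ≤ Real.exp (4 * G) := by
      have h2 : Real.exp (4 * G) = Real.exp (2 * G) * Real.exp (2 * G) := by
        rw [← Real.exp_add]
        congr 1
        ring
      rw [h2]
      nlinarith
    have h2 : (2 * (M : ℝ) + 1) ^ 2 ≤ Real.exp (8 * G) := by
      refine (pow_le_pow_left₀ (by positivity) h1 2).trans (le_of_eq ?_)
      rw [← Real.exp_nat_mul]
      congr 1
      push_cast
      ring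
    refine h2.trans_lt (Real.exp_lt_exp.2 ?_)
    rw [div_le_iff₀ hθ0] at hl1
    push_cast
    linarith
  · have h1 : ((2 * U ^ 2 : ℕ) : ℝ) + 1 ≤ Real.exp (8 * G) := by
      have h2 : Real.exp (8 * G) = Real.exp (2 * G) * Real.exp (3 * G) ^ 2 := by
        rw [← Real.exp_nat_mul, ← Real.exp_add]
        congr 1
        push_cast
        ring
      have h4 : (U : ℝ) ^ 2 ≤ Real.exp (3 * G) ^ 2 := pow_le_pow_left₀ hUpos.le hU2 2
      have h5 : 1 ≤ Real.exp (3 * G) ^ 2 := one_le_pow₀ (Real.one_le_exp (by linarith))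
      rw [h2]
      push_cast
      nlinarith
    calc (((2 * U ^ 2 : ℕ) : ℝ) + 1) ^ (2 * (l + 1))
        ≤ Real.exp (8 * G) ^ (2 * (l + 1)) := pow_le_pow_left₀ (by positivity) h1 _
      _ = Real.exp (16 * G * ((l + 1 : ℕ) : ℝ)) := by
        rw [← Real.exp_nat_mul]
        congr 1
        push_cast
        ring
      _ ≤ Real.exp (16 * G * (34 * G / θ)) :=
        Real.exp_le_exp.2 (mul_le_mul_of_nonneg_left hl2 (by positivity))
      _ = _ := by
        congr 1
        ring

lemma eventually_mul_rpow_le_exp (A r : ℝ) {a c : ℝ} (ha : 0 < a) (hc : 0 < c) :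
    ∀ᶠ x : ℝ in atTop, A * x ^ r ≤ Real.exp (c * x ^ a) := by
  have h1 := (tendsto_rpow_mul_exp_neg_mul_atTop_nhds_zero (r / a) c hc).comp
    (tendsto_rpow_atTop ha)
  have h2 := h1.const_mul A
  rw [mul_zero] at h2
  filter_upwards [h2.eventually_le_const zero_lt_one, eventually_ge_atTop 0] with x hx hx0
  simp only [Function.comp_apply] at hx
  rw [← Real.rpow_mul hx0, mul_div_cancel₀ _ ha.ne', neg_mul, Real.exp_neg, ← mul_assoc,
    ← div_eq_mul_inv, div_le_one (Real.exp_pos _)] at hx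
  exact hx

lemma eventually_le_mul_rpow (A : ℝ) {a c : ℝ} (ha : 0 < a) (hc : 0 < c) :
    ∀ᶠ x : ℝ in atTop, A ≤ c * x ^ a :=
  ((tendsto_rpow_atTop ha).const_mul_atTop hc).eventually_ge_atTop A

lemma half_le_floor {y : ℝ} (hy : 1 ≤ y) : y / 2 ≤ ⌊y⌋₊ := by
  have h1 := Nat.lt_floor_add_one y
  have h2 : (1 : ℝ) ≤ ⌊y⌋₊ := by exact_mod_cast Nat.le_floor (by exact_mod_cast hy)
  linarith

set_option maxHeartbeats 1000000 in
/-- The net for all large `n`; the numerical hypotheses hold for `n` large enough. -/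
lemma exists_net_of_large {κ ε C θ c₁ c₂ c₃ : ℝ} (hκ : 1 ≤ κ) (hε : 0 < ε) (hε1 : ε ≤ 1)
    (hθ : θ = 1 / (16 * κ ^ 6)) (hc₁ : c₁ = √(θ / (256 * κ))) (hc₂ : c₂ = √(θ / 32))
    (hc₃ : c₃ = 64 * (4 * κ ^ 2 / c₁ + 1) ^ 2) {n : ℕ} (hn : 1 ≤ n)
    (hnC : 64 * (n : ℝ) ^ C ≤ Real.exp (1 / 2 * (n : ℝ) ^ (ε / 16)))
    (hnE : (1 / c₁ + 8 * κ + 84) * (n : ℝ) ^ (2 : ℝ) ≤ Real.exp (1 * (n : ℝ) ^ (ε / 2)))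
    (hnk : 1 ≤ c₂ * (n : ℝ) ^ (1 / 2 - 13 * ε / 32))
    (hnA : c₃ ≤ c₂ * (n : ℝ) ^ (7 * ε / 32))
    (hnB : 8 * Real.exp (544 / θ + 3) ≤ 1 * (n : ℝ) ^ (ε / 4))
    (hnB' : 32 * Real.exp (544 / θ + 3) * c₃ ≤ c₂ * (n : ℝ) ^ (15 * ε / 32))
    (μ : Measure ℂ) [IsProbabilityMeasure μ]
    (hint : Integrable (fun a : ℂ => ‖a‖ ^ 2) μ) (hmom : ∫ a, ‖a‖ ^ 2 ∂μ ≤ κ)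
    (hvar : ∀ z w : ℂ, z.re ^ 2 / κ ≤ ∫ a in {a | ‖a‖ ≤ κ}, ((z * a - w).re) ^ 2 ∂μ)
    {β p : ℝ} (hβ : Real.exp (-(n : ℝ) ^ (ε / 2)) ≤ β) (hp : (n : ℝ) ^ (-C) ≤ p) :
    ∃ S' : Finset (Fin n → ℂ),
      (S'.card : ℝ) ≤ (n : ℝ) ^ ((-1 / 2 + ε) * n) * p ^ (-(n : ℝ))
        + Real.exp (3 * (n : ℝ) ^ (-(ε / 4)) * n) ∧
      ∀ v : Fin n → ℂ, (∑ i, ‖v i‖ ^ 2) = 1 → p ≤ smallBall μ v β →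
        ∃ v' ∈ S', ∀ i, ‖v i - v' i‖ ≤ β := by
  have hκ0 : 0 < κ := by linarith
  have hκ6 : 1 ≤ κ ^ 6 := one_le_pow₀ hκ
  have hθ0 : 0 < θ := by rw [hθ]; positivity
  have hθ1 : θ ≤ 1 / 16 := by
    rw [hθ, div_le_div_iff₀ (by positivity) (by norm_num)]
    linarith
  have hc₁0 : 0 < c₁ := by rw [hc₁]; positivity
  have hc₁sq : c₁ ^ 2 = θ / (256 * κ) := by rw [hc₁, Real.sq_sqrt (by positivity)]
  have hc₁1 : c₁ < 1 / 4 := by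
    refine lt_of_pow_lt_pow_left₀ 2 (by norm_num) ?_
    rw [hc₁sq, div_lt_iff₀ (by positivity)]
    linarith
  have hc₂0 : 0 < c₂ := by rw [hc₂]; positivity
  have hc₂sq : c₂ ^ 2 = θ / 32 := by rw [hc₂, Real.sq_sqrt (by positivity)]
  have hc₂1 : c₂ ≤ 1 := by
    refine le_of_sq_le_sq ?_ zero_le_one
    rw [hc₂sq]
    linarith
  have hc₃0 : 0 < c₃ := by rw [hc₃]; positivity
  set x : ℝ := (n : ℝ) with hx
  have hx1 : 1 ≤ x := by rw [hx]; exact_mod_cast hn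
  have hx0 : 0 < x := by linarith
  have hxpos : ∀ r : ℝ, 0 < x ^ r := fun r => Real.rpow_pos_of_pos hx0 r
  set G := x ^ (ε / 2) with hG
  have hG1 : 1 ≤ G := Real.one_le_rpow hx1 (by linarith)
  have hβ0 : 0 < β := (Real.exp_pos _).trans_le hβ
  have hp0 : 0 < p := (hxpos _).trans_le hp
  have hβinv : 1 / β ≤ Real.exp G := by
    rw [div_le_iff₀ hβ0]
    calc 1 = Real.exp G * Real.exp (-G) := by rw [← Real.exp_add]; simp
      _ ≤ _ := mul_le_mul_of_nonneg_left hβ (Real.exp_pos _).le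
  rw [one_mul, Real.rpow_two] at hnE
  rw [one_mul] at hnB
  set m := x ^ (ε / 16) with hm
  have hm1 : 1 ≤ m := Real.one_le_rpow hx1 (by linarith)
  have hm0 : 0 < m := by linarith
  set s := c₁ * x ^ (-(ε / 32)) with hs
  have hs0 : 0 < s := mul_pos hc₁0 (hxpos _)
  have hsc : s ≤ c₁ := mul_le_of_le_one_right hc₁0.le
    (Real.rpow_le_one_of_one_le_of_nonpos hx1 (by linarith))
  have hsm : m * s ^ 2 = c₁ ^ 2 := by
    rw [hm, hs, mul_pow, mul_left_comm, ← Real.rpow_natCast (x ^ (-(ε / 32))) 2,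
      ← Real.rpow_mul hx0.le, ← Real.rpow_add hx0]
    have : ε / 16 + -(ε / 32) * ((2 : ℕ) : ℝ) = 0 := by push_cast; ring
    rw [this, Real.rpow_zero, mul_one]
  have hsqm : √m / s = m / c₁ := by
    rw [hm, hs, Real.sqrt_eq_rpow, ← Real.rpow_mul hx0.le, mul_comm c₁, ← div_div,
      ← Real.rpow_sub hx0]
    congr 2
    ring
  set e := x ^ (-1 + 13 * ε / 16) with he
  have he0 : 0 < e := hxpos _
  set n' := ⌊x ^ (1 - 3 * ε / 4)⌋₊ with hn'
  have hn'1 : (n' : ℝ) ≤ x ^ (1 - 3 * ε / 4) := Nat.floor_le (hxpos _).le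
  have hn'n : n' ≤ n := by
    have : (n' : ℝ) ≤ n := hn'1.trans ((Real.rpow_le_rpow_of_exponent_le hx1
      (by linarith : 1 - 3 * ε / 4 ≤ 1)).trans_eq (Real.rpow_one _))
    exact_mod_cast this
  have hmn' : m < e * (n' + 1) := by
    have h1 := Nat.lt_floor_add_one (x ^ (1 - 3 * ε / 4))
    have h2 : m = e * x ^ (1 - 3 * ε / 4) := by
      rw [hm, he, ← Real.rpow_add hx0]
      congr 1
      ring
    rw [h2]
    exact mul_lt_mul_of_pos_left h1 he0
  set y := c₂ * x ^ (1 / 2 - 13 * ε / 32) with hy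
  set k := ⌊y⌋₊ with hk
  have hk1 : 1 ≤ k := Nat.le_floor (by exact_mod_cast hnk)
  have hky : (k : ℝ) ≤ y := Nat.floor_le (by linarith)
  have hyk : y / 2 ≤ k := half_le_floor hnk
  have hk0 : (0 : ℝ) < k := by exact_mod_cast hk1
  have hyx : y ≤ x := by
    calc y ≤ 1 * x ^ (1 : ℝ) := mul_le_mul hc₂1
          (Real.rpow_le_rpow_of_exponent_le hx1 (by linarith)) (hxpos _).le zero_le_one
      _ = x := by rw [one_mul, Real.rpow_one]
  have hke : (k : ℝ) ^ 2 * e ≤ θ / 32 := by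
    have h1 : y ^ 2 * e = c₂ ^ 2 := by
      rw [hy, he, mul_pow, mul_assoc, ← Real.rpow_natCast (x ^ _) 2, ← Real.rpow_mul hx0.le,
        ← Real.rpow_add hx0]
      have : (1 / 2 - 13 * ε / 32) * ((2 : ℕ) : ℝ) + (-1 + 13 * ε / 16) = 0 := by push_cast; ring
      rw [this, Real.rpow_zero, mul_one]
    rw [← hc₂sq, ← h1]
    exact mul_le_mul_of_nonneg_right (pow_le_pow_left₀ hk0.le hky 2) he0.le
  have hx2 : x ≤ x ^ 2 := le_self_pow₀ hx1 two_ne_zero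
  have hE : x ^ 2 / c₁ + 2 ≤ Real.exp G ∧ 8 * κ + 1 ≤ Real.exp G ∧ 81 * x ≤ Real.exp G := by
    have h1 : x ^ 2 / c₁ + 8 * κ * x ^ 2 + 84 * x ^ 2 ≤ Real.exp G := by
      refine le_trans (le_of_eq ?_) hnE
      ring
    have h2 : 0 ≤ x ^ 2 / c₁ := by positivity
    have h3 : 8 * κ ≤ 8 * κ * x ^ 2 := le_mul_of_one_le_right (by positivity) (hx1.trans hx2)
    have h4 : 0 < 8 * κ := by positivity
    exact ⟨by linarith, by linarith, by linarith⟩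
  have hexpG : 1 ≤ Real.exp G := Real.one_le_exp (by linarith)
  have hR : k * Real.exp G / s + 2 ≤ Real.exp (2 * G) := by
    have h1 : 1 / s ≤ x / c₁ := by
      rw [div_le_div_iff₀ hs0 hc₁0, one_mul, hs]
      have : 1 ≤ x * x ^ (-(ε / 32)) := by
        nth_rw 1 [← Real.rpow_one x]
        rw [← Real.rpow_add hx0]
        exact Real.one_le_rpow hx1 (by linarith)
      rw [mul_left_comm]
      exact le_mul_of_one_le_right hc₁0.le this
    have h2 : k * Real.exp G / s ≤ x * Real.exp G * (x / c₁) := by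
      rw [div_eq_mul_one_div]
      exact mul_le_mul (mul_le_mul_of_nonneg_right (hky.trans hyx) (Real.exp_pos _).le) h1
        (by positivity) (by positivity)
    have h3 : x * Real.exp G * (x / c₁) = x ^ 2 / c₁ * Real.exp G := by ring
    have h4 : Real.exp (2 * G) = Real.exp G * Real.exp G := by
      rw [← Real.exp_add]
      congr 1
      ring
    rw [h4]
    have h5 := mul_le_mul_of_nonneg_right hE.1 (Real.exp_pos G).le
    linarith
  obtain ⟨M, q, L, hL, hLe, hM, hML, hq, hLq⟩ := exists_sampling_params hκ hθ0 (by linarith) hs0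
    (by linarith) (by positivity) hG1 hR hE.2.1
  have hpm : Real.exp (-m / 2) ≤ p / 64 := by
    have h1 : Real.exp (-m / 2) = (Real.exp (1 / 2 * m))⁻¹ := by
      rw [← Real.exp_neg]
      congr 1
      ring
    have h2 : (Real.exp (1 / 2 * m))⁻¹ ≤ (64 * x ^ C)⁻¹ :=
      inv_anti₀ (mul_pos (by norm_num) (hxpos _)) hnC
    rw [mul_inv, ← Real.rpow_neg hx0.le] at h2
    rw [h1]
    linarith
  have hN : 64 * (4 * κ ^ 2 * √m / s + 1) ^ 2 / p ≤ c₃ * m ^ 2 / p := by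
    refine div_le_div_of_nonneg_right ?_ hp0.le
    have h1 : 4 * κ ^ 2 * √m / s + 1 ≤ (4 * κ ^ 2 / c₁ + 1) * m := by
      rw [mul_div_assoc, hsqm]
      have : (4 * κ ^ 2 / c₁ + 1) * m = 4 * κ ^ 2 * (m / c₁) + m := by ring
      linarith
    have h2 := pow_le_pow_left₀ (by positivity) h1 2
    rw [hc₃]
    linarith [mul_pow (4 * κ ^ 2 / c₁ + 1) m 2]
  have hX : (x * (4 * ⌈1 / β⌉₊ + 1) ^ 2) ^ n' ≤ Real.exp (3 * x ^ (-(ε / 4)) * x) := by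
    have h1 := Nat.ceil_lt_add_one (show 0 ≤ 1 / β by positivity)
    have h2 : (4 * (⌈1 / β⌉₊ : ℝ) + 1) ≤ 9 * Real.exp G := by linarith
    have h3 : x * (4 * (⌈1 / β⌉₊ : ℝ) + 1) ^ 2 ≤ Real.exp (3 * G) := by
      calc x * (4 * (⌈1 / β⌉₊ : ℝ) + 1) ^ 2 ≤ x * (9 * Real.exp G) ^ 2 := by gcongr
        _ = 81 * x * Real.exp G ^ 2 := by ring
        _ ≤ Real.exp G * Real.exp G ^ 2 := mul_le_mul_of_nonneg_right hE.2.2 (by positivity)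
        _ = Real.exp (3 * G) := by
          rw [← pow_succ', ← Real.exp_nat_mul]
          norm_num
    calc _ ≤ Real.exp (3 * G) ^ n' := pow_le_pow_left₀ (by positivity) h3 _
      _ = Real.exp (3 * G * n') := by rw [← Real.exp_nat_mul, mul_comm]
      _ ≤ Real.exp (3 * G * x ^ (1 - 3 * ε / 4)) :=
        Real.exp_le_exp.2 (mul_le_mul_of_nonneg_left hn'1 (by positivity))
      _ = _ := by
        congr 1
        rw [mul_assoc, mul_assoc, hG, ← Real.rpow_add hx0]
        congr 1
        nth_rw 3 [← Real.rpow_one x]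
        rw [← Real.rpow_add hx0]
        congr 1
        ring
  have hm2 : m ^ 2 = x ^ (ε / 8) := by
    rw [hm, ← Real.rpow_natCast, ← Real.rpow_mul hx0.le]
    congr 1
    push_cast
    ring
  refine exists_net_of_params hn'n μ hκ hint hmom hvar hβ0 hm0.le hpm hL hLe hs0 (by linarith) hθ
    ?_ (le_trans ?_ hM) hML hq he0 hk1 hke hmn' hN hX ?_
  · rw [mul_assoc, hsm, hc₁sq]
    exact le_of_eq (by field_simp)
  · gcongr
  · rcases le_or_gt (x ^ (-(1 / 2) + 3 * ε / 4)) p with hcase | hcase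
    · left
      refine ⟨?_, le_add_of_nonneg_left (by positivity)⟩
      refine lt_of_le_of_lt ?_ (Nat.lt_floor_add_one y)
      rw [div_le_iff₀ hp0, hm2]
      calc c₃ * x ^ (ε / 8) ≤ c₂ * x ^ (7 * ε / 32) * x ^ (ε / 8) :=
            mul_le_mul_of_nonneg_right hnA (hxpos _).le
        _ = y * x ^ (-(1 / 2) + 3 * ε / 4) := by
          rw [hy, mul_assoc, mul_assoc, ← Real.rpow_add hx0, ← Real.rpow_add hx0]
          congr 2
          ring
        _ ≤ _ := mul_le_mul_of_nonneg_left hcase (by linarith)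
    · right
      refine le_trans ?_ (le_add_of_nonneg_right (Real.exp_pos _).le)
      set D := Real.exp (544 / θ + 3) with hD
      have hD0 : 0 < D := Real.exp_pos _
      have hGx : G ^ 2 ≤ x := by
        rw [hG, ← Real.rpow_natCast, ← Real.rpow_mul hx0.le]
        refine (Real.rpow_le_rpow_of_exponent_le hx1 (?_ : _ ≤ (1 : ℝ))).trans_eq (Real.rpow_one _)
        push_cast
        linarith
      have hpre : ((L : ℝ) + 1) ^ (2 * q) * Real.exp (3 * x ^ (-(ε / 4)) * x) ≤ D ^ n := by
        refine (mul_le_mul_of_nonneg_right hLq (Real.exp_pos _).le).trans ?_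
        rw [hD, ← Real.exp_nat_mul, ← Real.exp_add, Real.exp_le_exp, ← hx]
        have h1 : 544 / θ * G ^ 2 ≤ 544 / θ * x := mul_le_mul_of_nonneg_left hGx (by positivity)
        have h2 : x ^ (-(ε / 4)) ≤ 1 :=
          Real.rpow_le_one_of_one_le_of_nonpos hx1 (by linarith)
        have h3 := mul_le_mul_of_nonneg_right h2 hx0.le
        linarith
      have hbase : D * (4 + 8 * (c₃ * m ^ 2 / p) / k) ≤ x ^ (-1 / 2 + ε) / p := by
        rw [le_div_iff₀ hp0]
        have h1 : 8 * D * p ≤ x ^ (-1 / 2 + ε) := by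
          calc 8 * D * p ≤ x ^ (ε / 4) * x ^ (-(1 / 2) + 3 * ε / 4) :=
                mul_le_mul hnB hcase.le hp0.le (hxpos _).le
            _ = _ := by
              rw [← Real.rpow_add hx0]
              congr 1
              ring
        have h2 : 16 * D * (c₃ * m ^ 2) ≤ x ^ (-1 / 2 + ε) * k := by
          calc 16 * D * (c₃ * m ^ 2) = (32 * D * c₃) * m ^ 2 / 2 := by ring
            _ ≤ (c₂ * x ^ (15 * ε / 32)) * x ^ (ε / 8) / 2 := by
              rw [hm2]
              gcongr
            _ = x ^ (-1 / 2 + ε) * (y / 2) := by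
              rw [hy, mul_assoc, ← Real.rpow_add hx0, mul_div_assoc', mul_left_comm,
                ← Real.rpow_add hx0]
              congr 3
              ring
            _ ≤ _ := mul_le_mul_of_nonneg_left hyk (hxpos _).le
        have h3 : 16 * D * (c₃ * m ^ 2) / k ≤ x ^ (-1 / 2 + ε) := (div_le_iff₀ hk0).2 h2
        have h4 : D * (4 + 8 * (c₃ * m ^ 2 / p) / k) * p
            = 8 * D * p / 2 + 16 * D * (c₃ * m ^ 2) / k / 2 := by
          field_simp
          ring
        rw [h4]
        linarith
      calc ((L : ℝ) + 1) ^ (2 * q) * Real.exp (3 * x ^ (-(ε / 4)) * x)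
            * (4 + 8 * (c₃ * m ^ 2 / p) / k) ^ n
          ≤ D ^ n * (4 + 8 * (c₃ * m ^ 2 / p) / k) ^ n := by gcongr
        _ = (D * (4 + 8 * (c₃ * m ^ 2 / p) / k)) ^ n := (mul_pow _ _ _).symm
        _ ≤ (x ^ (-1 / 2 + ε) / p) ^ n := pow_le_pow_left₀ (by positivity) hbase n
        _ = _ := by
          rw [div_pow, Real.rpow_neg hp0.le, hx, Real.rpow_mul (Nat.cast_nonneg n),
            Real.rpow_natCast, Real.rpow_natCast, div_eq_mul_inv]

/-- **Inverse Littlewood–Offord theorem** (Theorem 3.2). -/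
theorem inverse_littlewood_offord
    (κ ε C : ℝ) (hκ : 1 ≤ κ) (hε : 0 < ε) (hε1 : ε ≤ 1) (hC : 0 < C) :
    ∃ (n₀ : ℕ) (δ : ℕ → ℝ), 1 ≤ n₀ ∧ (∀ n, 0 < δ n) ∧ Tendsto δ atTop (nhds 0) ∧
      ∀ n : ℕ, n₀ ≤ n →
      ∀ (Ω : Type) [MeasureSpace Ω], IsProbabilityMeasure (ℙ : Measure Ω) →
      ∀ α : Ω → ℂ, Measurable α → HasControlledSecondMoment α κ →
      ∀ β p : ℝ, Real.exp (-(n : ℝ) ^ (ε / 2)) ≤ β → (n : ℝ) ^ (-C) ≤ p → p ≤ 1 →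
        ∃ S' : Finset (Fin n → ℂ),
          (S'.card : ℝ) ≤ (n : ℝ) ^ ((-1 / 2 + ε) * n) * p ^ (-(n : ℝ))
              + Real.exp (δ n * n) ∧
          ∀ v : Fin n → ℂ, (∑ i, ‖v i‖ ^ 2) = 1 →
            p ≤ smallBall (Measure.map α ℙ) v β →
            ∃ v' ∈ S', ∀ i, ‖v i - v' i‖ ≤ β := by
  have hκ0 : 0 < κ := by linarith
  obtain ⟨θ, hθ⟩ : ∃ θ, θ = 1 / (16 * κ ^ 6) := ⟨_, rfl⟩
  have hθ0 : 0 < θ := by rw [hθ]; positivity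
  obtain ⟨c₁, hc₁⟩ : ∃ c₁, c₁ = √(θ / (256 * κ)) := ⟨_, rfl⟩
  obtain ⟨c₂, hc₂⟩ : ∃ c₂, c₂ = √(θ / 32) := ⟨_, rfl⟩
  obtain ⟨c₃, hc₃⟩ : ∃ c₃, c₃ = 64 * (4 * κ ^ 2 / c₁ + 1) ^ 2 := ⟨_, rfl⟩
  have hc₂0 : 0 < c₂ := by rw [hc₂]; positivity
  have hev := (eventually_mul_rpow_le_exp 64 C (by positivity : 0 < ε / 16)
      (by norm_num : (0 : ℝ) < 1 / 2)).and <|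
    (eventually_mul_rpow_le_exp (1 / c₁ + 8 * κ + 84) 2 (half_pos hε) zero_lt_one).and <|
    (eventually_le_mul_rpow 1 (by linarith : 0 < 1 / 2 - 13 * ε / 32) hc₂0).and <|
    (eventually_le_mul_rpow c₃ (by positivity : 0 < 7 * ε / 32) hc₂0).and <|
    (eventually_le_mul_rpow (8 * Real.exp (544 / θ + 3)) (by positivity : 0 < ε / 4)
      zero_lt_one).and <|
    eventually_le_mul_rpow (32 * Real.exp (544 / θ + 3) * c₃) (by positivity : 0 < 15 * ε / 32)
      hc₂0
  obtain ⟨N, hN⟩ := eventually_atTop.1 ((tendsto_natCast_atTop_atTop (R := ℝ)).eventually hev)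
  refine ⟨max N 1, fun n => 3 * (n : ℝ) ^ (-(ε / 4)) + 1 / ((n : ℝ) + 1), le_max_right _ _,
    fun n => by positivity, ?_, ?_⟩
  · have h := (((tendsto_rpow_neg_atTop (by positivity : 0 < ε / 4)).comp
      (tendsto_natCast_atTop_atTop (R := ℝ))).const_mul 3).add
      (tendsto_one_div_add_atTop_nhds_zero_nat (𝕜 := ℝ))
    simpa using h
  · intro n hn Ω _ _ α hα ⟨_, hint, hmom, hvar⟩ β p hβ hp _
    obtain ⟨hnC, hnE, hnk, hnA, hnB, hnB'⟩ := hN n ((le_max_left _ _).trans hn)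
    have hα' : AEMeasurable α (ℙ : Measure Ω) := hα.aemeasurable
    have hsq : AEStronglyMeasurable (fun a : ℂ => ‖a‖ ^ 2) (Measure.map α ℙ) := by fun_prop
    have := Measure.isProbabilityMeasure_map hα'
    obtain ⟨S', hcard, hS'⟩ := exists_net_of_large hκ hε hε1 hθ hc₁ hc₂ hc₃
      ((le_max_right _ _).trans hn) hnC hnE hnk hnA hnB hnB' (Measure.map α ℙ)
      ((integrable_map_measure hsq hα').2 hint) (by rwa [integral_map hα' hsq])
      (fun z w => by
        rw [setIntegral_map (measurableSet_le measurable_norm measurable_const) (by fun_prop) hα']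
        exact hvar z w) hβ hp
    refine ⟨S', hcard.trans ?_, hS'⟩
    gcongr
    exact le_add_of_nonneg_right (by positivity)
end

section
/- Let α be a complex random variable and 0 < μ ≤ 1. Then: (i) for fixed w, P_μ(w) is non-increasing in μ and is invariant under permutations of the entries of w; (ii) for any tuples v, w of complex numbers, P_μ(v⌢w) ≤ P_μ(v), where v⌢w denotes the concatenation of v and w; (iii) for any tuples v, w, P_μ(v)·P_μ(w) ≤ 2·P_μ(v⌢w); (iv) for any integer k ≥ 1 and any tuple v, P_μ(v) ≤ P_{μ/k}(v^k), where v^k denotes the concatenation of k copies of v; (v) for any tuples v, w₁, …, w_m, P_μ(v⌢w₁⌢…⌢w_m) ≤ (∏_{i=1}^{m} P_μ(v⌢w_i^m))^{1/m}. -/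
open MeasureTheory ProbabilityTheory Filter

theorem one_sub_mul_one_sub_mem_Icc {μ f : ℝ} (hμ : 0 ≤ μ) (hμ1 : μ ≤ 1) (hf : 0 ≤ f)
    (hf1 : f ≤ 1) : 1 - μ / 2 * (1 - f) ∈ Set.Icc (0 : ℝ) 1 := by
  constructor <;> nlinarith [mul_nonneg hμ hf, mul_nonneg hμ (sub_nonneg.2 hf1)]

theorem charFn_nonneg (ν : Measure ℂ) (z : ℂ) : 0 ≤ charFn ν z := by
  unfold charFn; positivity

theorem norm_cexp_two_pi_mul_I (t : ℝ) :
    ‖Complex.exp (2 * Real.pi * Complex.I * (t : ℂ))‖ = 1 := by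
  rw [show (2 * Real.pi * Complex.I * (t : ℂ) : ℂ) = ((2 * Real.pi * t : ℝ) : ℂ) * Complex.I by
    push_cast; ring]
  exact Complex.norm_exp_ofReal_mul_I _

theorem charFn_le_one (ν : Measure ℂ) [IsProbabilityMeasure ν] (z : ℂ) : charFn ν z ≤ 1 := by
  unfold charFn
  refine pow_le_one₀ (norm_nonneg _) ((norm_integral_le_integral_norm _).trans ?_)
  simp only [norm_cexp_two_pi_mul_I]
  simp

theorem charFn_neg (ν : Measure ℂ) (z : ℂ) : charFn ν (-z) = charFn ν z := by
  unfold charFn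
  have h : ∀ w : ℂ, Complex.exp (2 * Real.pi * Complex.I * ((w * -z).re : ℂ)) =
      (starRingEnd ℂ) (Complex.exp (2 * Real.pi * Complex.I * ((w * z).re : ℂ))) := by
    intro w
    rw [← Complex.exp_conj]
    congr 1
    simp [Complex.conj_ofNat]
    ring
  simp_rw [h, integral_conj, RCLike.norm_conj]

theorem integrable_cexp_two_pi (ν : Measure ℂ) [IsFiniteMeasure ν] (z : ℂ) :
    Integrable (fun w => Complex.exp (2 * Real.pi * Complex.I * ((w * z).re : ℂ))) ν := by
  refine Integrable.of_bound (C := 1) (by fun_prop) (ae_of_all _ fun w => ?_)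
  exact (norm_cexp_two_pi_mul_I _).le

theorem continuous_charFn (ν : Measure ℂ) [IsFiniteMeasure ν] : Continuous (charFn ν) := by
  unfold charFn
  refine (continuous_norm.comp ?_).pow 2
  refine continuous_of_dominated (bound := fun _ => 1) (fun z => by fun_prop) (fun z => ?_)
    (integrable_const _) (ae_of_all _ fun w => by fun_prop)
  exact ae_of_all _ fun w => (norm_cexp_two_pi_mul_I _).le

instance isProbabilityMeasure_map_sub (ν : Measure ℂ) [IsProbabilityMeasure ν] :
    IsProbabilityMeasure (Measure.map (fun p : ℂ × ℂ => p.1 - p.2) (ν.prod ν)) :=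
  Measure.isProbabilityMeasure_map (by fun_prop)

theorem isProbabilityMeasure_diffLaw (ν : Measure ℂ) [IsProbabilityMeasure ν] {μ : ℝ}
    (hμ : 0 ≤ μ) (hμ1 : μ ≤ 1) : IsProbabilityMeasure (diffLaw ν μ) := by
  constructor
  simp only [diffLaw, Measure.add_apply, Measure.smul_apply, measure_univ, smul_eq_mul, mul_one]
  rw [← ENNReal.ofReal_add (by linarith) (by linarith)]
  simp

theorem integral_cexp_map_sub (ν : Measure ℂ) [IsProbabilityMeasure ν] (z : ℂ) :
    ∫ w, Complex.exp (2 * Real.pi * Complex.I * ((w * z).re : ℂ))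
      ∂(Measure.map (fun p : ℂ × ℂ => p.1 - p.2) (ν.prod ν)) = (charFn ν z : ℂ) := by
  rw [integral_map (by fun_prop) (by fun_prop)]
  have h : ∀ p : ℂ × ℂ, Complex.exp (2 * Real.pi * Complex.I * (((p.1 - p.2) * z).re : ℂ)) =
      Complex.exp (2 * Real.pi * Complex.I * ((p.1 * z).re : ℂ)) *
        (starRingEnd ℂ) (Complex.exp (2 * Real.pi * Complex.I * ((p.2 * z).re : ℂ))) := by
    intro p
    rw [← Complex.exp_conj, ← Complex.exp_add]
    congr 1
    simp [Complex.conj_ofNat]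
    ring
  simp_rw [h]
  rw [integral_prod_mul (fun w : ℂ => Complex.exp (2 * Real.pi * Complex.I * ((w * z).re : ℂ)))
    (fun w : ℂ => (starRingEnd ℂ) (Complex.exp (2 * Real.pi * Complex.I * ((w * z).re : ℂ)))),
    integral_conj, Complex.mul_conj, charFn, Complex.normSq_eq_norm_sq]

theorem integral_cexp_diffLaw (ν : Measure ℂ) [IsProbabilityMeasure ν] {μ : ℝ}
    (hμ : 0 ≤ μ) (hμ1 : μ ≤ 1) (z : ℂ) :
    ∫ w, Complex.exp (2 * Real.pi * Complex.I * ((w * z).re : ℂ)) ∂(diffLaw ν μ) =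
      ((1 - μ / 2 * (1 - charFn ν z) : ℝ) : ℂ) := by
  unfold diffLaw
  rw [integral_add_measure ((integrable_cexp_two_pi _ z).smul_measure ENNReal.ofReal_ne_top)
    ((integrable_cexp_two_pi _ z).smul_measure ENNReal.ofReal_ne_top), integral_smul_measure,
    integral_smul_measure, integral_cexp_map_sub, integral_dirac,
    ENNReal.toReal_ofReal (by linarith), ENNReal.toReal_ofReal (by linarith)]
  simp
  ring

theorem integral_gaussian_mul_cexp (w : ℂ) :
    ∫ z : ℂ, Complex.exp (-Real.pi * ‖z‖ ^ 2) *
      Complex.exp (2 * Real.pi * Complex.I * ((w * z).re : ℂ)) =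
        ((Real.exp (-Real.pi * ‖w‖ ^ 2) : ℝ) : ℂ) := by
  have h := GaussianFourier.integral_cexp_neg_mul_sq_norm_add (V := ℂ) (b := (Real.pi : ℂ))
    (by simpa using Real.pi_pos) (2 * Real.pi * Complex.I) ((starRingEnd ℂ) w)
  have hpi : (Real.pi : ℂ) ≠ 0 := by exact_mod_cast Real.pi_ne_zero
  simp only [Complex.inner, Complex.conj_conj, Complex.finrank_real_complex, div_self hpi,
    Complex.one_cpow, one_mul, RCLike.norm_conj] at h
  simp_rw [← Complex.exp_add, mul_comm w]
  refine h.trans ?_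
  push_cast
  congr 1
  field_simp
  rw [Complex.I_sq]
  ring

theorem integrable_exp_neg_pi_mul_sq_norm :
    Integrable (fun z : ℂ => Real.exp (-Real.pi * ‖z‖ ^ 2)) := by
  have h := (GaussianFourier.integrable_cexp_neg_mul_sq_norm_add (V := ℂ) (b := (Real.pi : ℂ))
    (by simpa using Real.pi_pos) 0 0).re
  refine h.congr (ae_of_all _ fun z => ?_)
  simp only [zero_mul, add_zero]
  rw [show (-(Real.pi : ℂ) * (‖z‖ : ℂ) ^ 2) = ((-Real.pi * ‖z‖ ^ 2 : ℝ) : ℂ) by push_cast; ring,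
    ← Complex.ofReal_exp]
  exact Complex.ofReal_re _

/-- The Fourier-side integrand of the concentration probability. -/
noncomputable def concIntegrand {ι : Type*} [Fintype ι] (ν : Measure ℂ) (μ : ℝ) (v : ι → ℂ) (z : ℂ) : ℝ :=
  Real.exp (-Real.pi * ‖z‖ ^ 2) * ∏ i, (1 - μ / 2 * (1 - charFn ν (v i * z)))

theorem concIntegrand_sumElim {ι ι' : Type*} [Fintype ι] [Fintype ι'] (ν : Measure ℂ) (μ : ℝ)
    (v : ι → ℂ) (w : ι' → ℂ) (z : ℂ) :
    concIntegrand ν μ (Sum.elim v w) z =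
      concIntegrand ν μ v z * ∏ i, (1 - μ / 2 * (1 - charFn ν (w i * z))) := by
  simp [concIntegrand, Fintype.prod_sum_type, mul_assoc]

section Fourier

variable {ι ι' : Type*} [Fintype ι] [Fintype ι'] (ν : Measure ℂ) [IsProbabilityMeasure ν] {μ : ℝ}

theorem concProb_eq_integral_concIntegrand (hμ : 0 ≤ μ) (hμ1 : μ ≤ 1) (v : ι → ℂ) :
    concProb ν μ v = ∫ z, concIntegrand ν μ v z := by
  have := isProbabilityMeasure_diffLaw ν hμ hμ1
  apply Complex.ofReal_injective
  unfold concProb concIntegrand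
  rw [← integral_complex_ofReal, ← integral_complex_ofReal]
  simp_rw [← integral_gaussian_mul_cexp]
  rw [integral_integral_swap]
  · congr 1
    ext z
    rw [integral_const_mul]
    push_cast
    congr 1
    have h : ∀ x : ι → ℂ, Complex.exp (2 * Real.pi * Complex.I * (((∑ i, v i * x i) * z).re : ℂ)) =
        ∏ i, Complex.exp (2 * Real.pi * Complex.I * ((x i * (v i * z)).re : ℂ)) := by
      intro x
      rw [← Complex.exp_sum, ← Finset.mul_sum, ← Complex.ofReal_sum, ← Complex.re_sum,
        Finset.sum_mul]
      congr 5
      ext i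
      ring
    simp_rw [h]
    rw [integral_fintype_prod_eq_prod
      (f := fun i w => Complex.exp (2 * Real.pi * Complex.I * ((w * (v i * z)).re : ℂ)))]
    refine Finset.prod_congr rfl fun i _ => ?_
    rw [integral_cexp_diffLaw ν hμ hμ1]
    push_cast
    rfl
  · refine ((integrable_const (1 : ℝ)).mul_prod integrable_exp_neg_pi_mul_sq_norm).mono'
      (Continuous.aestronglyMeasurable (by fun_prop)) (ae_of_all _ fun p => ?_)
    simp only [Function.uncurry]
    rw [norm_mul, norm_cexp_two_pi_mul_I, Complex.norm_exp]
    simp [← Complex.ofReal_pow]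

theorem concIntegrand_nonneg (hμ : 0 ≤ μ) (hμ1 : μ ≤ 1) (v : ι → ℂ) (z : ℂ) :
    0 ≤ concIntegrand ν μ v z :=
  mul_nonneg (Real.exp_pos _).le (Finset.prod_nonneg fun _ _ =>
    (one_sub_mul_one_sub_mem_Icc hμ hμ1 (charFn_nonneg _ _) (charFn_le_one _ _)).1)

theorem continuous_concIntegrand (v : ι → ℂ) : Continuous (concIntegrand ν μ v) := by
  have := continuous_charFn ν
  unfold concIntegrand
  fun_prop

theorem integrable_concIntegrand (hμ : 0 ≤ μ) (hμ1 : μ ≤ 1) (v : ι → ℂ) :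
    Integrable (concIntegrand ν μ v) := by
  refine integrable_exp_neg_pi_mul_sq_norm.mono'
    (continuous_concIntegrand ν v).aestronglyMeasurable (ae_of_all _ fun z => ?_)
  rw [Real.norm_of_nonneg (concIntegrand_nonneg ν hμ hμ1 v z)]
  have h i := one_sub_mul_one_sub_mem_Icc hμ hμ1 (charFn_nonneg ν (v i * z)) (charFn_le_one _ _)
  exact mul_le_of_le_one_right (Real.exp_pos _).le
    (Finset.prod_le_one (fun i _ => (h i).1) fun i _ => (h i).2)

theorem concProb_antitone {μ' : ℝ} (hμ : 0 ≤ μ) (hμμ' : μ ≤ μ') (hμ'1 : μ' ≤ 1) (w : ι → ℂ) :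
    concProb ν μ' w ≤ concProb ν μ w := by
  have hμ' := hμ.trans hμμ'
  have hμ1 := hμμ'.trans hμ'1
  rw [concProb_eq_integral_concIntegrand ν hμ hμ1, concProb_eq_integral_concIntegrand ν hμ' hμ'1]
  refine integral_mono (integrable_concIntegrand ν hμ' hμ'1 w) (integrable_concIntegrand ν hμ hμ1 w)
    fun z => mul_le_mul_of_nonneg_left (Finset.prod_le_prod (fun i _ => ?_) fun i _ => ?_)
      (Real.exp_pos _).le
  · exact (one_sub_mul_one_sub_mem_Icc hμ' hμ'1 (charFn_nonneg _ _) (charFn_le_one _ _)).1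
  · have := charFn_le_one ν (w i * z)
    nlinarith

theorem concProb_comp_equiv (hμ : 0 ≤ μ) (hμ1 : μ ≤ 1) (w : ι → ℂ) (e : ι' ≃ ι) :
    concProb ν μ (w ∘ e) = concProb ν μ w := by
  rw [concProb_eq_integral_concIntegrand ν hμ hμ1, concProb_eq_integral_concIntegrand ν hμ hμ1]
  congr 1
  ext z
  unfold concIntegrand
  rw [← Equiv.prod_comp e]
  rfl

theorem concProb_sumElim_le (hμ : 0 ≤ μ) (hμ1 : μ ≤ 1) (v : ι → ℂ) (w : ι' → ℂ) :
    concProb ν μ (Sum.elim v w) ≤ concProb ν μ v := by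
  rw [concProb_eq_integral_concIntegrand ν hμ hμ1, concProb_eq_integral_concIntegrand ν hμ hμ1]
  refine integral_mono (integrable_concIntegrand ν hμ hμ1 _) (integrable_concIntegrand ν hμ hμ1 _)
    fun z => ?_
  rw [concIntegrand_sumElim]
  have h i := one_sub_mul_one_sub_mem_Icc hμ hμ1 (charFn_nonneg ν (w i * z)) (charFn_le_one _ _)
  exact mul_le_of_le_one_right (concIntegrand_nonneg ν hμ hμ1 v z)
    (Finset.prod_le_one (fun i _ => (h i).1) fun i _ => (h i).2)

theorem concProb_sumElim_neg (hμ : 0 ≤ μ) (hμ1 : μ ≤ 1) (v : ι → ℂ) (w : ι' → ℂ) :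
    concProb ν μ (Sum.elim v (-w)) = concProb ν μ (Sum.elim v w) := by
  rw [concProb_eq_integral_concIntegrand ν hμ hμ1, concProb_eq_integral_concIntegrand ν hμ hμ1]
  congr 1
  ext z
  simp [concIntegrand_sumElim, charFn_neg]

theorem concProb_sumElim_eq_integral_prod (hμ : 0 ≤ μ) (hμ1 : μ ≤ 1) (v : ι → ℂ) (w : ι' → ℂ) :
    concProb ν μ (Sum.elim v w) =
      ∫ p : (ι → ℂ) × (ι' → ℂ), Real.exp (-Real.pi * ‖∑ i, v i * p.1 i + ∑ i, w i * p.2 i‖ ^ 2)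
        ∂((Measure.pi fun _ : ι => diffLaw ν μ).prod (Measure.pi fun _ : ι' => diffLaw ν μ)) := by
  have := isProbabilityMeasure_diffLaw ν hμ hμ1
  rw [← (measurePreserving_sumPiEquivProdPi (fun _ : ι ⊕ ι' => diffLaw ν μ)).integral_comp
    (MeasurableEquiv.measurableEmbedding _)]
  unfold concProb
  simp only [Fintype.sum_sum_type]
  rfl

theorem concProb_mul_le_concProb_sumElim (hμ : 0 ≤ μ) (hμ1 : μ ≤ 1) (v : ι → ℂ) (w : ι' → ℂ) :
    concProb ν μ v * concProb ν μ w ≤ concProb ν μ (Sum.elim v w) := by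
  have := isProbabilityMeasure_diffLaw ν hμ hμ1
  have key : concProb ν μ v * concProb ν μ w ≤
      (concProb ν μ (Sum.elim v w) + concProb ν μ (Sum.elim v (-w))) / 2 := by
    have hint : ∀ f : (ι → ℂ) × (ι' → ℂ) → ℝ, Continuous f → (∀ p, 0 ≤ f p) →
        Integrable (fun p => Real.exp (-Real.pi * f p))
          ((Measure.pi fun _ : ι => diffLaw ν μ).prod (Measure.pi fun _ : ι' => diffLaw ν μ)) := by
      intro f hf h0
      refine Integrable.of_bound (C := 1) (Continuous.aestronglyMeasurable (by fun_prop))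
        (ae_of_all _ fun p => ?_)
      rw [Real.norm_of_nonneg (Real.exp_pos _).le, Real.exp_le_one_iff]
      nlinarith [Real.pi_pos, h0 p]
    rw [concProb_sumElim_eq_integral_prod ν hμ hμ1, concProb_sumElim_eq_integral_prod ν hμ hμ1,
      concProb, concProb, ← integral_prod_mul, ← integral_add, ← integral_div]
    · refine integral_mono ?_ (Integrable.div_const (Integrable.add ?_ ?_) 2) fun p => ?_
      · simp_rw [← Real.exp_add, ← mul_add]
        exact hint _ (by fun_prop) fun p => by positivity
      · exact hint _ (by fun_prop) fun p => by positivity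
      · exact hint _ (by fun_prop) fun p => by positivity
      · simp only [Pi.neg_apply, neg_mul (w _), Finset.sum_neg_distrib, ← sub_eq_add_neg]
        set X := ∑ i, v i * p.1 i
        set Y := ∑ i, w i * p.2 i
        have hpar := parallelogram_law_with_norm ℝ X Y
        have h2 : Real.exp (-Real.pi * ‖X‖ ^ 2) * Real.exp (-Real.pi * ‖Y‖ ^ 2) =
            Real.exp (-Real.pi * ‖X + Y‖ ^ 2 / 2) * Real.exp (-Real.pi * ‖X - Y‖ ^ 2 / 2) := by
          rw [← Real.exp_add, ← Real.exp_add]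
          congr 1
          linear_combination Real.pi / 2 * hpar
        have h3 : ∀ t : ℝ, Real.exp t = Real.exp (t / 2) ^ 2 := by
          intro t
          rw [← Real.exp_nat_mul]
          congr 1
          push_cast
          ring
        rw [h2, h3 (-Real.pi * ‖X + Y‖ ^ 2), h3 (-Real.pi * ‖X - Y‖ ^ 2)]
        nlinarith [sq_nonneg (Real.exp (-Real.pi * ‖X + Y‖ ^ 2 / 2) -
          Real.exp (-Real.pi * ‖X - Y‖ ^ 2 / 2))]
    · exact hint _ (by fun_prop) fun p => by positivity
    · exact hint _ (by fun_prop) fun p => by positivity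
  rw [concProb_sumElim_neg ν hμ hμ1] at key
  linarith

theorem concProb_le_concProb_div_replicate (hμ : 0 ≤ μ) (hμ1 : μ ≤ 1) (v : ι → ℂ) {k : ℕ}
    (hk : 1 ≤ k) :
    concProb ν μ v ≤ concProb ν (μ / k) (fun p : ι × Fin k => v p.1) := by
  have hk' : (1 : ℝ) ≤ k := by exact_mod_cast hk
  have hμk : 0 ≤ μ / k := by positivity
  have hμk1 : μ / k ≤ 1 := (div_le_self hμ hk').trans hμ1
  rw [concProb_eq_integral_concIntegrand ν hμ hμ1, concProb_eq_integral_concIntegrand ν hμk hμk1]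
  refine integral_mono (integrable_concIntegrand ν hμ hμ1 _)
    (integrable_concIntegrand ν hμk hμk1 _) fun z => ?_
  unfold concIntegrand
  rw [Fintype.prod_prod_type]
  refine mul_le_mul_of_nonneg_left (Finset.prod_le_prod (fun i _ => ?_) fun i _ => ?_)
      (Real.exp_pos _).le
  · exact (one_sub_mul_one_sub_mem_Icc hμ hμ1 (charFn_nonneg _ _) (charFn_le_one _ _)).1
  · simp only [Finset.prod_const, Finset.card_univ, Fintype.card_fin]
    have h := one_sub_mul_one_sub_mem_Icc hμk hμk1 (charFn_nonneg ν (v i * z)) (charFn_le_one _ _)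
    have hb := one_add_mul_le_pow (a := -(μ / k / 2 * (1 - charFn ν (v i * z))))
      (by linarith [h.1]) k
    rw [← sub_eq_add_neg] at hb
    refine le_trans (le_of_eq ?_) hb
    field_simp
    ring

end Fourier

/-- **Hölder's inequality** for a finite family of nonnegative real functions. -/
theorem integral_prod_rpow_le {X J : Type*} [MeasurableSpace X] {ρ : Measure X} (s : Finset J)
    {f : J → X → ℝ} (hf : ∀ j ∈ s, Integrable (f j) ρ) (hf0 : ∀ j ∈ s, ∀ x, 0 ≤ f j x)
    {p : J → ℝ} (hp : ∑ j ∈ s, p j = 1) (hp0 : ∀ j ∈ s, 0 ≤ p j) :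
    ∫ x, ∏ j ∈ s, f j x ^ p j ∂ρ ≤ ∏ j ∈ s, (∫ x, f j x ∂ρ) ^ p j := by
  have hR : ∀ j ∈ s, 0 ≤ (∫ x, f j x ∂ρ) ^ p j := fun j hj =>
    Real.rpow_nonneg (integral_nonneg (hf0 j hj)) _
  rw [integral_eq_lintegral_of_nonneg_ae
    (ae_of_all _ fun x => Finset.prod_nonneg fun j hj => Real.rpow_nonneg (hf0 j hj x) _)]
  · refine ENNReal.toReal_le_of_le_ofReal (Finset.prod_nonneg hR) ?_
    have h := ENNReal.lintegral_prod_norm_pow_le (μ := ρ) s (f := fun j x => ENNReal.ofReal (f j x))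
      (fun j hj => (hf j hj).aestronglyMeasurable.aemeasurable.ennreal_ofReal) hp hp0
    rw [ENNReal.ofReal_prod_of_nonneg hR]
    refine le_trans (le_of_eq ?_) (h.trans (le_of_eq ?_))
    · congr 1
      ext x
      rw [ENNReal.ofReal_prod_of_nonneg fun j hj => Real.rpow_nonneg (hf0 j hj x) _]
      exact Finset.prod_congr rfl fun j hj =>
        (ENNReal.ofReal_rpow_of_nonneg (hf0 j hj x) (hp0 j hj)).symm
    · refine Finset.prod_congr rfl fun j hj => ?_
      rw [← ofReal_integral_eq_lintegral_ofReal (hf j hj) (ae_of_all _ (hf0 j hj)),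
        ENNReal.ofReal_rpow_of_nonneg (integral_nonneg (hf0 j hj)) (hp0 j hj)]
  · refine AEMeasurable.aestronglyMeasurable (Finset.aemeasurable_fun_prod _ fun j hj => ?_)
    exact (hf j hj).aestronglyMeasurable.aemeasurable.pow_const _

theorem concProb_sumElim_sigma_le {ι : Type*} [Fintype ι] (ν : Measure ℂ) [IsProbabilityMeasure ν]
    {μ : ℝ} (hμ : 0 ≤ μ) (hμ1 : μ ≤ 1) (v : ι → ℂ) {m : ℕ} (hm : 1 ≤ m) {κ : Fin m → Type*}
    [∀ j, Fintype (κ j)] (w : (j : Fin m) → κ j → ℂ) :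
    concProb ν μ (Sum.elim v (fun p : Σ j, κ j => w p.1 p.2)) ≤
      (∏ j, concProb ν μ (Sum.elim v (fun p : κ j × Fin m => w j p.1))) ^ (1 / (m : ℝ)) := by
  have hm0 : (m : ℝ) ≠ 0 := by positivity
  simp_rw [concProb_eq_integral_concIntegrand ν hμ hμ1]
  rw [← Real.finsetProd_rpow _ _ fun j _ =>
    integral_nonneg (concIntegrand_nonneg ν hμ hμ1 _)]
  refine le_trans (le_of_eq ?_) (integral_prod_rpow_le (p := fun _ => 1 / (m : ℝ)) Finset.univ
    (fun j _ => integrable_concIntegrand ν hμ hμ1 _)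
    (fun j _ => concIntegrand_nonneg ν hμ hμ1 _) (by simp [hm0]) fun _ _ => by positivity)
  congr 1
  ext z
  have hF : ∀ j, 0 ≤ ∏ i, (1 - μ / 2 * (1 - charFn ν (w j i * z))) := fun j =>
    Finset.prod_nonneg fun _ _ =>
      (one_sub_mul_one_sub_mem_Icc hμ hμ1 (charFn_nonneg _ _) (charFn_le_one _ _)).1
  have hg := concIntegrand_nonneg ν hμ hμ1 v z
  simp only [concIntegrand_sumElim, Fintype.prod_prod_type, Fintype.prod_sigma, Finset.prod_const,
    Finset.card_univ, Fintype.card_fin, Finset.prod_pow]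
  rw [Finset.prod_congr rfl fun j _ => Real.mul_rpow hg (pow_nonneg (hF j) m),
    Finset.prod_mul_distrib, Finset.prod_const, Finset.card_univ, Fintype.card_fin, one_div,
    Real.rpow_inv_natCast_pow hg (by omega)]
  congr 1
  exact Finset.prod_congr rfl fun j _ => (Real.pow_rpow_inv_natCast (hF j) (by omega)).symm

/-- **Properties of the concentration probability `P_μ`** (Lemma 4.5). -/
theorem concProb_properties
    {Ω : Type*} [MeasureSpace Ω] [IsProbabilityMeasure (ℙ : Measure Ω)]
    (α : Ω → ℂ) (hmeas : Measurable α)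
    (μ : ℝ) (hμ : 0 < μ) (hμ1 : μ ≤ 1) :
    -- (i) monotone decreasing in μ
    (∀ (ι : Type) [Fintype ι] (w : ι → ℂ) (μ' : ℝ), 0 < μ' → μ' ≤ 1 → μ ≤ μ' →
      concProb (Measure.map α ℙ) μ' w ≤ concProb (Measure.map α ℙ) μ w) ∧
    -- (i) permutation invariance
    (∀ (ι : Type) [Fintype ι] (w : ι → ℂ) (e : ι ≃ ι),
      concProb (Measure.map α ℙ) μ (w ∘ e) = concProb (Measure.map α ℙ) μ w) ∧
    -- (ii) concatenation decreases P_μ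
    (∀ (ι ι' : Type) [Fintype ι] [Fintype ι'] (v : ι → ℂ) (w : ι' → ℂ),
      concProb (Measure.map α ℙ) μ (Sum.elim v w) ≤ concProb (Measure.map α ℙ) μ v) ∧
    -- (iii) submultiplicativity
    (∀ (ι ι' : Type) [Fintype ι] [Fintype ι'] (v : ι → ℂ) (w : ι' → ℂ),
      concProb (Measure.map α ℙ) μ v * concProb (Measure.map α ℙ) μ w
        ≤ 2 * concProb (Measure.map α ℙ) μ (Sum.elim v w)) ∧
    -- (iv) repetition
    (∀ (ι : Type) [Fintype ι] (v : ι → ℂ) (k : ℕ), 1 ≤ k →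
      concProb (Measure.map α ℙ) μ v
        ≤ concProb (Measure.map α ℙ) (μ / k) (fun p : ι × Fin k => v p.1)) ∧
    -- (v) Hölder-type inequality
    (∀ (ι : Type) [Fintype ι] (v : ι → ℂ) (m : ℕ), 1 ≤ m →
      ∀ (κ : Fin m → Type) [∀ j, Fintype (κ j)] (w : (j : Fin m) → κ j → ℂ),
        concProb (Measure.map α ℙ) μ (Sum.elim v (fun p : Σ j, κ j => w p.1 p.2))
          ≤ (∏ j, concProb (Measure.map α ℙ) μ
                (Sum.elim v (fun p : κ j × Fin m => w j p.1))) ^ (1 / (m : ℝ))) := by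
  have := Measure.isProbabilityMeasure_map (μ := (ℙ : Measure Ω)) hmeas.aemeasurable
  exact ⟨fun ι _ w μ' _ hμ'1 hle => concProb_antitone _ hμ.le hle hμ'1 w,
    fun ι _ w e => concProb_comp_equiv _ hμ.le hμ1 w e,
    fun ι ι' _ _ v w => concProb_sumElim_le _ hμ.le hμ1 v w,
    fun ι ι' _ _ v w => by
      have h0 : 0 ≤ concProb (Measure.map α ℙ) μ (Sum.elim v w) :=
        integral_nonneg fun _ => (Real.exp_pos _).le
      linarith [concProb_mul_le_concProb_sumElim (Measure.map α ℙ) hμ.le hμ1 v w],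
    fun ι _ v k hk => concProb_le_concProb_div_replicate _ hμ.le hμ1 v hk,
    fun ι _ v m hm κ _ w => concProb_sumElim_sigma_le _ hμ.le hμ1 v hm w⟩
end
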